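/- arXiv:1804.00990 — 2 statements merged into one kernel-verified Lean document; each statement's English description precedes it below -/
import Mathlib

section
/- Let d, h, t, u be integers with 1 ≤ u < d − n + t and 0 < t < h ≤ n, and let x be any monomial in P_n. Set Z = φ_{(t;I_t)}(X^{2^{d−u}−1}) · X_h^{2^d − 2^{d−u}} · x^{2^d} (a monomial in P_n) and let ω = ω(Z) be its weight vector. Then Z + φ_{(t;I_t)}(X^{2^d−1}) · x^{2^d} ∈ A_{n−t+1}^+P_n + P_n^−(ω). -/
open MvPolynomial

noncomputable section

/-- `P n` is the polynomial algebra `F_2[x_1, …, x_n]`, with `x_{k+1}` corresponding to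
the variable indexed by `k : Fin n`. -/
abbrev P (n : ℕ) : Type := MvPolynomial (Fin n) (ZMod 2)

/-- The total Steenrod square, the ring homomorphism determined by `x_i ↦ x_i + x_i^2`. -/
def sqTot (n : ℕ) : P n →ₐ[ZMod 2] P n := bind₁ fun i => X i + X i ^ 2

/-- The Steenrod square `Sq^k`: on a homogeneous polynomial of degree `d` it is the
homogeneous component of degree `d + k` of the total square, extended additively. -/
def SqK (n k : ℕ) (f : P n) : P n :=
  ∑ d ∈ Finset.range (f.totalDegree + 1),
    homogeneousComponent (d + k) (sqTot n (homogeneousComponent d f))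

/-- `A^+ P_n = Σ_{j ≥ 1} Sq^j(P_n)`, the submodule of hit polynomials. -/
def hitS (n : ℕ) : Submodule (ZMod 2) (P n) :=
  Submodule.span (ZMod 2) {g | ∃ j, 1 ≤ j ∧ ∃ h, g = SqK n j h}

/-- `A_s^+ P_n = Σ_{1 ≤ j < 2^s} Sq^j(P_n)`. -/
def AplusS (n s : ℕ) : Submodule (ZMod 2) (P n) :=
  Submodule.span (ZMod 2) {g | ∃ j, 1 ≤ j ∧ j < 2 ^ s ∧ ∃ h, g = SqK n j h}

/-- Degree of a monomial given by its exponent vector. -/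
def mdeg {n : ℕ} (a : Fin n →₀ ℕ) : ℕ := ∑ j, a j

/-- The weight vector of a monomial, zero-based: `wt a i = ω_{i+1}(x) = Σ_j α_i(a_j)`. -/
def wt {n : ℕ} (a : Fin n →₀ ℕ) (i : ℕ) : ℕ := ∑ j, a j / 2 ^ i % 2

/-- Left-lexicographic strict order on weight vectors. -/
def lexLt (w w' : ℕ → ℕ) : Prop := ∃ i, (∀ j, j < i → w j = w' j) ∧ w i < w' i

def lexLe (w w' : ℕ → ℕ) : Prop := w = w' ∨ lexLt w w'

/-- `P_n^-(ω)`: span of monomials of degree `D = deg ω` with weight vector `< ω`. -/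
def PnLt (n D : ℕ) (w : ℕ → ℕ) : Submodule (ZMod 2) (P n) :=
  Submodule.span (ZMod 2)
    {p | ∃ a : Fin n →₀ ℕ, mdeg a = D ∧ lexLt (wt a) w ∧ p = monomial a 1}

/-- `P_n(ω)`: span of monomials of degree `D = deg ω` with weight vector `≤ ω`. -/
def PnLe (n D : ℕ) (w : ℕ → ℕ) : Submodule (ZMod 2) (P n) :=
  Submodule.span (ZMod 2)
    {p | ∃ a : Fin n →₀ ℕ, mdeg a = D ∧ lexLe (wt a) w ∧ p = monomial a 1}

/-- The order on monomials (of a common degree): first by weight vector, then by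
exponent vector, both left-lexicographically. -/
def monLt {n : ℕ} (a b : Fin n →₀ ℕ) : Prop :=
  lexLt (wt a) (wt b) ∨
    (wt a = wt b ∧ ∃ j : Fin n, (∀ k, k < j → a k = b k) ∧ a j < b j)

/-- A monomial is inadmissible if it is congruent, modulo hit elements, to a sum of
strictly smaller monomials of the same degree. -/
def Inadmissible {n : ℕ} (a : Fin n →₀ ℕ) : Prop :=
  ∃ S : Finset (Fin n →₀ ℕ), (∀ b ∈ S, mdeg b = mdeg a ∧ monLt b a) ∧
    ((monomial a 1 : P n) + ∑ b ∈ S, monomial b 1) ∈ hitS n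

def Admissible {n : ℕ} (a : Fin n →₀ ℕ) : Prop := ¬ Inadmissible a

/-- Strict inadmissibility: with `s` the top of the weight vector, the monomial is
congruent to a sum of smaller monomials modulo `A_s^+ P_n`. -/
def StrictlyInadmissible {n : ℕ} (a : Fin n →₀ ℕ) : Prop :=
  ∃ s : ℕ, 1 ≤ s ∧ wt a (s - 1) ≠ 0 ∧ (∀ i, s ≤ i → wt a i = 0) ∧
    ∃ S : Finset (Fin n →₀ ℕ), (∀ b ∈ S, mdeg b = mdeg a ∧ monLt b a) ∧
      ((monomial a 1 : P n) + ∑ b ∈ S, monomial b 1) ∈ AplusS n s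

/-- Exponent vector from a tuple of exponents. -/
def ev {n : ℕ} (v : Fin n → ℕ) : Fin n →₀ ℕ := Finsupp.equivFunOnFinite.symm v

/-- `ν_k(x)`, the exponent of the (1-based) variable `x_k` in a monomial. -/
def nuE {m : ℕ} (b : Fin m →₀ ℕ) (k : ℕ) : ℕ := if h : k - 1 < m then b ⟨k - 1, h⟩ else 0

/-- `u`-compatibility of a monomial of `P_{n-1}` with a pair `(i; I)` (only `I` matters);
by convention every monomial is `1`-compatible with `(i; ∅)`. -/
def uCompat {m : ℕ} (I : List ℕ) (u : ℕ) (b : Fin m →₀ ℕ) : Prop :=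
  if I = [] then u = 1 else
    1 ≤ u ∧ u ≤ I.length ∧
    (∀ t, 1 ≤ t → t < u → nuE b (I.getD (t - 1) 0 - 1) = 2 ^ I.length - 1) ∧
    2 ^ I.length - 1 < nuE b (I.getD (u - 1) 0 - 1) ∧
    (∀ t, 1 ≤ t → t ≤ u → Nat.testBit (nuE b (I.getD (u - 1) 0 - 1)) (I.length - t) = true) ∧
    (∀ t, u < t → t ≤ I.length → Nat.testBit (nuE b (I.getD (t - 1) 0 - 1)) (I.length - t) = true)

/-- The exponent vector of `x_{(I,u)} = x_{i_u}^{2^{r-1}+⋯+2^{r-u}} Π_{u<t≤r} x_{i_t}^{2^{r-t}}`. -/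
def xIuExp (n : ℕ) (I : List ℕ) (u : ℕ) : Fin n → ℕ := fun k =>
  (if I.getD (u - 1) 0 = (k : ℕ) + 1 then 2 ^ I.length - 2 ^ (I.length - u) else 0) +
  ∑ t ∈ Finset.Icc (u + 1) I.length,
    if I.getD (t - 1) 0 = (k : ℕ) + 1 then 2 ^ (I.length - t) else 0

/-- The variable substitution underlying `f_i : P_{n-1} → P_n` (`x_j ↦ x_j` for `j < i`,
`x_j ↦ x_{j+1}` for `j ≥ i`, in 1-based labels). -/
def fIdx (n i : ℕ) (j : Fin (n - 1)) : Fin n :=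
  if (j : ℕ) + 1 < i then ⟨j, by have := j.isLt; omega⟩
  else ⟨(j : ℕ) + 1, by have := j.isLt; omega⟩

open Classical in
/-- `φ_{(i;I)}` evaluated on the monomial of `P_{n-1}` with exponent vector `b`:
`(x_i^{2^r - 1} f_i(x)) / x_{(I,u)}` if `x` is `u`-compatible with `(i;I)` for some `u`,
and `0` otherwise.  Here `i` and the entries of `I` are 1-based variable labels. -/
def phiMon (n i : ℕ) (I : List ℕ) (b : Fin (n - 1) →₀ ℕ) : P n :=
  if h : ∃ u, uCompat I u b then
    monomial (ev fun k : Fin n =>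
      (if (k : ℕ) + 1 = i then 2 ^ I.length - 1 else 0) +
        Finsupp.mapDomain (fIdx n i) b k - xIuExp n I (Classical.choose h) k) 1
  else 0

/-- Exponent vector of `X^e = (x_1 ⋯ x_m)^e` in `P_m`. -/
def Xexp (m e : ℕ) : Fin m →₀ ℕ := ev fun _ => e

/-- `X_u^e = (Π_{j ≠ u} x_j)^e` in `P_n` (`u` 1-based). -/
def XjMon (n u e : ℕ) : P n := monomial (ev fun k : Fin n => if (k : ℕ) + 1 = u then 0 else e) 1

/-- `x_u^e` in `P_n` (`u` 1-based). -/
def xvMon (n u e : ℕ) : P n := monomial (ev fun k : Fin n => if (k : ℕ) + 1 = u then e else 0) 1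

/-- The weight vector `((n-1)^{(d)}, 1)` (zero-based indexing). -/
def wSpike (n d : ℕ) : ℕ → ℕ := fun i => if i < d then n - 1 else if i = d then 1 else 0

/-- Kameko's map `ψ : P_5 → P_5`, `x_1x_2x_3x_4x_5 · y^2 ↦ y` on monomials, `0` otherwise. -/
def psi : P 5 →ₗ[ZMod 2] P 5 :=
  (basisMonomials (Fin 5) (ZMod 2)).constr (ZMod 2) fun a =>
    if ∀ j, Odd (a j) then monomial (Finsupp.mapRange (· / 2) (Nat.zero_div 2) a) 1 else 0

/-- The Σ₅-invariant subspace of a subspace `V` of `QP_5 = P_5 / A^+P_5`: classes in `V`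
having a representative `f` with `[σ · f] = [f]` for all permutations `σ` of the variables. -/
def invSub (V : Submodule (ZMod 2) (P 5 ⧸ hitS 5)) : Submodule (ZMod 2) (P 5 ⧸ hitS 5) where
  carrier := {q | q ∈ V ∧ ∃ f : P 5, (hitS 5).mkQ f = q ∧
      ∀ σ : Equiv.Perm (Fin 5), (hitS 5).mkQ (rename (⇑σ) f) = q}
  add_mem' := by
    rintro a b ⟨haV, f, hf, hfa⟩ ⟨hbV, g, hg, hgb⟩
    refine ⟨V.add_mem haV hbV, f + g, ?_, fun σ => ?_⟩
    · simp [map_add, hf, hg]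
    · simp [map_add, hfa σ, hgb σ]
  zero_mem' := ⟨V.zero_mem, 0, by simp, fun σ => by simp⟩
  smul_mem' := by
    rintro c a ⟨haV, f, hf, hfa⟩
    refine ⟨V.smul_mem c haV, c • f, ?_, fun σ => ?_⟩
    · simp [map_smul, hf]
    · simp [map_smul, hfa σ]

/-- The maps `ρ_1, …, ρ_5` generating the action of `GL_5` on `P_5`:
`ρ_i` (for `1 ≤ i ≤ 4`) swaps `x_i, x_{i+1}`; `ρ_5` sends `x_1 ↦ x_1 + x_2`. -/
def rho5 (i : ℕ) : P 5 → P 5 := fun f =>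
  if i = 1 then rename (⇑(Equiv.swap (0 : Fin 5) 1)) f
  else if i = 2 then rename (⇑(Equiv.swap (1 : Fin 5) 2)) f
  else if i = 3 then rename (⇑(Equiv.swap (2 : Fin 5) 3)) f
  else if i = 4 then rename (⇑(Equiv.swap (3 : Fin 5) 4)) f
  else if i = 5 then MvPolynomial.aeval (R := ZMod 2)
    (fun j : Fin 5 => if j = 0 then X 0 + X 1 else X j) f
  else f

/-- The action of an invertible matrix on `P_5` by linear substitution of the variables. -/
def glAct (g : Matrix (Fin 5) (Fin 5) (ZMod 2)) (f : P 5) : P 5 :=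
  MvPolynomial.aeval (R := ZMod 2) (fun i : Fin 5 => ∑ j : Fin 5, g i j • X j) f

/-- The weight vector `(3,3,4)` (zero-based indexing). -/
def w334 : ℕ → ℕ := fun i => if i = 0 then 3 else if i = 1 then 3 else if i = 2 then 4 else 0

/-- The weight vector `(3,3,2,1)` (zero-based indexing). -/
def w3321 : ℕ → ℕ := fun i =>
  if i = 0 then 3 else if i = 1 then 3 else if i = 2 then 2 else if i = 3 then 1 else 0

lemma ev_apply {n : ℕ} (v : Fin n → ℕ) (k : Fin n) : ev v k = v k := rfl

lemma sqTot_mon (n : ℕ) (F : Fin n →₀ ℕ) :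
    sqTot n (monomial F 1) = ∑ v ∈ Fintype.piFinset (fun j => Finset.range (F j + 1)),
      monomial (F + ev v) (∏ j, ((F j).choose (v j) : ZMod 2)) := by
  have h1 : sqTot n (monomial F 1) = ∏ j, (X j + X j ^ 2 : P n) ^ F j := by
    unfold sqTot
    rw [bind₁_monomial, C_1, one_mul]
    apply Finset.prod_subset (Finset.subset_univ _)
    intro j _ hj
    rw [Finsupp.notMem_support_iff.mp hj, pow_zero]
  have h2 : ∀ j, (X j + X j ^ 2 : P n) ^ F j = ∑ v ∈ Finset.range (F j + 1),
      monomial (Finsupp.single j (F j + v)) ((F j).choose v : ZMod 2) := by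
    intro j
    rw [add_comm, add_pow]
    apply Finset.sum_congr rfl
    intro v hv
    have hv' : v ≤ F j := by simpa [Nat.lt_succ_iff] using hv
    have : (X j ^ 2 : P n) ^ v * X j ^ (F j - v) = X j ^ (F j + v) := by
      rw [← pow_mul, ← pow_add]; congr 1; omega
    rw [this, X_pow_eq_monomial]
    have h3 : (((F j).choose v : ℕ) : P n) = C ((F j).choose v : ZMod 2) := by simp
    rw [h3, mul_comm, C_mul_monomial, mul_one]
  rw [h1, Finset.prod_congr rfl (fun j _ => h2 j), Finset.prod_univ_sum]
  apply Finset.sum_congr rfl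
  intro v _
  have h4 : ∀ s : Finset (Fin n), ∏ i ∈ s, (monomial (Finsupp.single i (F i + v i)) ((F i).choose (v i) : ZMod 2) : P n)
      = monomial (∑ i ∈ s, Finsupp.single i (F i + v i)) (∏ j ∈ s, ((F j).choose (v j) : ZMod 2)) := by
    intro s
    induction s using Finset.induction_on with
    | empty => simp
    | insert i s hi ih => rw [Finset.prod_insert hi, ih, monomial_mul, Finset.sum_insert hi, Finset.prod_insert hi]
  rw [h4]
  congr 2
  ext k
  rw [Finsupp.finsetSum_apply, Finset.sum_eq_single k]
  · simp [ev_apply]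
  · intro j _ hj
    rw [Finsupp.single_apply, if_neg hj]
  · simp

lemma coeff_sq (n : ℕ) (F b : Fin n →₀ ℕ) :
    coeff (F + b) (sqTot n (monomial F 1)) = ∏ j, ((F j).choose (b j) : ZMod 2) := by
  classical
  rw [sqTot_mon, coeff_sum]
  simp only [coeff_monomial, add_right_inj]
  by_cases hb : ∀ j, b j ≤ F j
  · rw [Finset.sum_eq_single (fun j => b j)]
    · rw [if_pos]; ext; rfl
    · intro v _ hv
      rw [if_neg]
      intro h; apply hv; funext j; rw [← h]; rfl
    · intro h
      exfalso; apply h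
      simp only [Fintype.mem_piFinset, Finset.mem_range]
      intro j; have := hb j; omega
  · push Not at hb
    obtain ⟨j, hj⟩ := hb
    rw [Finset.prod_eq_zero (Finset.mem_univ j) (by rw [Nat.choose_eq_zero_of_lt hj]; simp)]
    apply Finset.sum_eq_zero
    intro v hv
    rw [if_neg]
    intro h
    simp only [Fintype.mem_piFinset, Finset.mem_range] at hv
    have h1 := hv j
    have : b j = v j := by rw [← h]; rfl
    omega

lemma supp_sq (n : ℕ) (F b : Fin n →₀ ℕ) (h : coeff b (sqTot n (monomial F 1)) ≠ 0) :
    ∃ c : Fin n →₀ ℕ, b = F + c ∧ ∀ j, c j ≤ F j := by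
  classical
  have : F ≤ b := by
    by_contra hF
    apply h
    rw [sqTot_mon, coeff_sum]
    apply Finset.sum_eq_zero
    intro v _
    rw [coeff_monomial, if_neg]
    rintro rfl
    exact hF le_self_add
  obtain ⟨c, rfl⟩ := exists_add_of_le this
  refine ⟨c, rfl, fun j => ?_⟩
  by_contra hj
  apply h
  rw [coeff_sq]
  apply Finset.prod_eq_zero (Finset.mem_univ j)
  rw [Nat.choose_eq_zero_of_lt (by omega)]; simp

/-- the exponent vector of `X_c` -/
def oneC {n : ℕ} (c : Fin n) : Fin n →₀ ℕ := ev fun k => if k = c then 0 else 1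

def Ee {n : ℕ} (x : Fin n →₀ ℕ) : List (Fin n) → (Fin n →₀ ℕ)
  | [] => x
  | c :: l => oneC c + 2 • Ee x l

lemma Ee_append {n : ℕ} (x : Fin n →₀ ℕ) (l l' : List (Fin n)) :
    Ee x (l ++ l') = Ee (Ee x l') l := by
  induction l with
  | nil => rfl
  | cons c l ih => simp [Ee, ih]

lemma mdeg_add {n : ℕ} (a b : Fin n →₀ ℕ) : mdeg (a + b) = mdeg a + mdeg b := by
  simp [mdeg, Finset.sum_add_distrib]

lemma mdeg_two {n : ℕ} (a : Fin n →₀ ℕ) : mdeg (2 • a) = 2 * mdeg a := by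
  simp [mdeg, Finset.mul_sum]

lemma sum_oneC {n : ℕ} (c : Fin n) : ∑ j, oneC c j = n - 1 := by
  simp only [oneC, ev_apply]
  rw [← Finset.sum_erase_add _ _ (Finset.mem_univ c)]
  rw [Finset.sum_congr rfl (g := fun _ => 1)]
  · simp [Finset.card_erase_of_mem]
  · intro j hj; simp [Finset.ne_of_mem_erase hj]

lemma oneC_le {n : ℕ} (c j : Fin n) : oneC c j ≤ 1 := by
  simp only [oneC, ev_apply]; split <;> omega

lemma wt_zero {n : ℕ} (s b : Fin n →₀ ℕ) : wt (s + 2 • b) 0 = ∑ j, s j % 2 := by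
  simp [wt]

lemma wt_succ {n : ℕ} (s b : Fin n →₀ ℕ) (hs : ∀ j, s j ≤ 1) (i : ℕ) :
    wt (s + 2 • b) (i + 1) = wt b i := by
  simp only [wt]
  apply Finset.sum_congr rfl
  intro j _
  have := hs j
  rw [pow_succ', ← Nat.div_div_eq_div_mul]
  congr 2
  simp
  omega

lemma wt_oneC_zero {n : ℕ} (c : Fin n) (b : Fin n →₀ ℕ) : wt (oneC c + 2 • b) 0 = n - 1 := by
  rw [wt_zero, ← sum_oneC c]
  apply Finset.sum_congr rfl
  intro j _
  have := oneC_le c j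
  omega

lemma mdeg_oneC {n : ℕ} (c : Fin n) : mdeg (oneC c) = n - 1 := sum_oneC c

lemma lexLt_shift {n : ℕ} (c : Fin n) (b : Fin n →₀ ℕ) (c' : Fin n) (b' : Fin n →₀ ℕ)
    (h : lexLt (wt b) (wt b')) : lexLt (wt (oneC c + 2 • b)) (wt (oneC c' + 2 • b')) := by
  obtain ⟨i, h1, h2⟩ := h
  refine ⟨i + 1, ?_, ?_⟩
  · intro j hj
    cases j with
    | zero => rw [wt_oneC_zero, wt_oneC_zero]
    | succ j => rw [wt_succ _ _ (oneC_le c), wt_succ _ _ (oneC_le c')]; exact h1 j (by omega)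
  · rw [wt_succ _ _ (oneC_le c), wt_succ _ _ (oneC_le c')]; exact h2

lemma mdeg_Ee {n : ℕ} (x : Fin n →₀ ℕ) (l l' : List (Fin n)) (h : l.length = l'.length) :
    mdeg (Ee x l) = mdeg (Ee x l') := by
  induction l generalizing l' with
  | nil => rw [List.length_eq_zero_iff.mp h.symm]
  | cons c l ih =>
    cases l' with
    | nil => simp at h
    | cons c' l' =>
      simp only [Ee, mdeg_add, mdeg_two, mdeg_oneC, ih l' (by simpa using h)]

lemma wt_Ee {n : ℕ} (x : Fin n →₀ ℕ) (l l' : List (Fin n)) (h : l.length = l'.length) :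
    wt (Ee x l) = wt (Ee x l') := by
  induction l generalizing l' with
  | nil => rw [List.length_eq_zero_iff.mp h.symm]
  | cons c l ih =>
    cases l' with
    | nil => simp at h
    | cons c' l' =>
      funext i
      cases i with
      | zero => simp only [Ee, wt_oneC_zero]
      | succ i => simp only [Ee, wt_succ _ _ (oneC_le _), ih l' (by simpa using h)]

def Good {n : ℕ} (i : ℕ) (F A B : Fin n →₀ ℕ) : Prop :=
  ∀ b, coeff b (sqTot n (monomial F 1) + monomial A 1 + monomial B 1 : P n) ≠ 0 →
    mdeg b = mdeg F + 2 ^ i → lexLt (wt b) (wt A)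

lemma sq_frob {n : ℕ} (F : Fin n →₀ ℕ) (s : Fin n →₀ ℕ) :
    (monomial (s + 2 • F) 1 : P n) = monomial s 1 * (monomial F 1) ^ 2 := by
  rw [monomial_pow, monomial_mul]; simp

lemma coeff_mul_ne {n : ℕ} (f g : P n) (b : Fin n →₀ ℕ) (h : coeff b (f * g) ≠ 0) :
    ∃ s c, b = s + c ∧ coeff s f ≠ 0 ∧ coeff c g ≠ 0 := by
  classical
  rw [coeff_mul] at h
  obtain ⟨⟨s, c⟩, h1, h2⟩ := Finset.exists_ne_zero_of_sum_ne_zero h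
  exact ⟨s, c, (Finset.HasAntidiagonal.mem_antidiagonal.mp h1).symm, left_ne_zero_of_mul h2, right_ne_zero_of_mul h2⟩

lemma coeff_sq_ne {n : ℕ} (f : P n) (b : Fin n →₀ ℕ) (h : coeff b (f ^ 2) ≠ 0) :
    ∃ c, b = 2 • c ∧ coeff c f ≠ 0 := by
  classical
  have : f ^ 2 = ∑ c ∈ f.support, monomial (2 • c) (coeff c f ^ 2) := by
    conv_lhs => rw [f.as_sum]
    rw [sum_pow_char 2]
    simp [monomial_pow]
  rw [this, coeff_sum] at h
  obtain ⟨c, h1, h2⟩ := Finset.exists_ne_zero_of_sum_ne_zero h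
  rw [coeff_monomial] at h2
  refine ⟨c, ?_, mem_support_iff.mp h1⟩
  by_contra h3
  rw [if_neg (fun h => h3 h.symm)] at h2
  exact h2 rfl

lemma two_zero {n : ℕ} (f : P n) : f + f = 0 := CharTwo.add_self_eq_zero f

lemma Good_step {n : ℕ} (i : ℕ) (F A B : Fin n →₀ ℕ) (c : Fin n) (h : Good i F A B) :
    Good (i + 1) (oneC c + 2 • F) (oneC c + 2 • A) (oneC c + 2 • B) := by
  intro b hb hd
  set R : P n := sqTot n (monomial F 1) + monomial A 1 + monomial B 1 with hR
  have key : (sqTot n (monomial (oneC c + 2 • F) 1) + monomial (oneC c + 2 • A) 1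
      + monomial (oneC c + 2 • B) 1 : P n) = monomial (oneC c) 1 * R ^ 2 +
      (sqTot n (monomial (oneC c) 1) + monomial (oneC c) 1) * (sqTot n (monomial F 1)) ^ 2 := by
    rw [sq_frob, sq_frob, sq_frob, map_mul, map_pow, hR, CharTwo.add_sq, CharTwo.add_sq]
    linear_combination - two_zero (monomial (oneC c) 1 * (sqTot n (monomial F 1)) ^ 2)
  rw [key, coeff_add] at hb
  have : coeff b (monomial (oneC c) 1 * R ^ 2) ≠ 0 ∨ coeff b ((sqTot n (monomial (oneC c) 1) + monomial (oneC c) 1) * (sqTot n (monomial F 1)) ^ 2) ≠ 0 := by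
    by_contra h; push Not at h; rw [h.1, h.2] at hb; simp at hb
  rcases this with h1 | h1
  · obtain ⟨s, e, rfl, hs, he⟩ := coeff_mul_ne _ _ _ h1
    obtain ⟨g, rfl, hg⟩ := coeff_sq_ne _ _ he
    have : s = oneC c := by
      classical
      rw [coeff_monomial] at hs
      by_contra h3
      rw [if_neg (fun h => h3 h.symm)] at hs
      exact hs rfl
    subst this
    apply lexLt_shift
    apply h g hg
    simp only [mdeg_add, mdeg_two] at hd
    rw [pow_succ] at hd
    omega
  · obtain ⟨s, e, rfl, hs, he⟩ := coeff_mul_ne _ _ _ h1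
    obtain ⟨g, rfl, hg⟩ := coeff_sq_ne _ _ he
    refine ⟨0, by omega, ?_⟩
    rw [wt_oneC_zero, wt_zero, ← sum_oneC c]
    have hne : s ≠ oneC c := by
      rintro rfl
      apply hs
      have := coeff_sq n (oneC c) 0
      rw [add_zero] at this
      rw [coeff_add, this]
      simp [CharTwo.add_self_eq_zero]
    have hs' : coeff s (sqTot n (monomial (oneC c) 1)) ≠ 0 := by
      classical
      rwa [coeff_add, coeff_monomial, if_neg (fun h => hne h.symm), add_zero] at hs
    obtain ⟨v, rfl, hv⟩ := supp_sq _ _ _ hs'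
    have hv0 : v ≠ 0 := by rintro rfl; simp at hne
    obtain ⟨j, hj⟩ := Finsupp.ne_iff.mp hv0
    apply Finset.sum_lt_sum
    · intro j _
      have := hv j; have := oneC_le c j
      simp only [Finsupp.add_apply]
      omega
    · refine ⟨j, Finset.mem_univ _, ?_⟩
      have := hv j; have := oneC_le c j
      simp only [Finsupp.add_apply, Finsupp.coe_zero, Pi.zero_apply] at *
      omega

def allOne (n : ℕ) : Fin n →₀ ℕ := ev fun _ => 1

/-- the source of the square -/
def Fk {n : ℕ} (p q : Fin n) (z : Fin n →₀ ℕ) : ℕ → (Fin n →₀ ℕ)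
  | 0 => (ev fun k => if k = p ∨ k = q then 0 else 1) + 2 • z
  | k + 1 => allOne n + 2 • Fk p q z k

lemma one_add_single {n : ℕ} (p : Fin n) (G : Fin n →₀ ℕ) :
    allOne n + 2 • G + Finsupp.single p 1 = oneC p + 2 • (G + Finsupp.single p 1) := by
  ext k
  simp only [allOne, oneC, ev_apply, Finsupp.add_apply, Finsupp.smul_apply, Finsupp.single_apply, smul_eq_mul]
  by_cases h : p = k
  · subst h; simp; ring
  · rw [if_neg h, if_neg (fun h' => h h'.symm)]; ring

lemma Fk_single {n : ℕ} (p q : Fin n) (hpq : p ≠ q) (x : Fin n →₀ ℕ) (l : List (Fin n)) (k : ℕ) :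
    Fk p q (Ee x l) k + Finsupp.single p 1 = Ee x (List.replicate k p ++ q :: l) := by
  induction k with
  | zero =>
    simp only [Fk, List.replicate_zero, List.nil_append, Ee]
    rw [add_right_comm]
    congr 1
    ext j
    simp only [oneC, ev_apply, Finsupp.add_apply, Finsupp.single_apply]
    by_cases h : p = j
    · subst h; simp [hpq]
    · by_cases h2 : j = q
      · subst h2; simp [h]
      · simp [h, h2, Ne.symm h]
  | succ k ih =>
    simp only [Fk, List.replicate_succ, List.cons_append, Ee]
    rw [one_add_single, ih]

lemma Fk_symm {n : ℕ} (p q : Fin n) (z : Fin n →₀ ℕ) (k : ℕ) : Fk p q z k = Fk q p z k := by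
  induction k with
  | zero => simp only [Fk, or_comm]
  | succ k ih => simp only [Fk, ih]

lemma Fk_lt {n : ℕ} (p q j : Fin n) (hpq : p ≠ q) (hj : j ≠ p) (hj' : j ≠ q) (z : Fin n →₀ ℕ) (k : ℕ) :
    lexLt (wt (Fk p q z k + Finsupp.single j 1)) (wt (Fk p q z k + Finsupp.single p 1)) := by
  induction k with
  | zero =>
    refine ⟨0, by omega, ?_⟩
    simp only [Fk]
    rw [add_right_comm, add_right_comm _ _ (Finsupp.single p 1), wt_zero, wt_zero]
    apply Finset.sum_lt_sum
    · intro k _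
      simp only [ev_apply, Finsupp.add_apply, Finsupp.single_apply]
      by_cases h1 : k = p
      · subst h1; simp [hj]
      · by_cases h2 : k = q
        · subst h2; simp [hj']
        · by_cases h3 : j = k
          · subst h3; simp [h1, h2]
          · simp [h1, h2, h3, Ne.symm h1]
    · refine ⟨p, Finset.mem_univ _, ?_⟩
      simp [ev_apply, hj]
  | succ k ih =>
    simp only [Fk]
    rw [one_add_single, one_add_single]
    exact lexLt_shift _ _ _ _ ih

lemma Good_base {n : ℕ} (p q : Fin n) (hpq : p ≠ q) (z : Fin n →₀ ℕ) (k : ℕ) :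
    Good 0 (Fk p q z (k + 1)) (Fk p q z (k + 1) + Finsupp.single p 1)
      (Fk p q z (k + 1) + Finsupp.single q 1) := by
  classical
  intro b hb hd
  set F := Fk p q z (k + 1) with hF
  have hodd : ∀ j, (F j : ZMod 2) = 1 := by
    intro j
    have h2 : (2 : ZMod 2) = 0 := rfl
    simp [hF, Fk, allOne, ev_apply, h2]
  have hc : ∀ j, coeff (F + Finsupp.single j 1) (sqTot n (monomial F 1)) = 1 := by
    intro j
    rw [coeff_sq, Finset.prod_eq_single j]
    · simp [hodd]
    · intro i _ hi
      rw [Finsupp.single_apply, if_neg (Ne.symm hi)]; simp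
    · simp
  have hs : ∀ i j : Fin n, Finsupp.single i 1 = (Finsupp.single j 1 : Fin n →₀ ℕ) → i = j := by
    intro i j h
    exact (Finsupp.single_left_inj (by norm_num)).mp h
  by_cases h1 : b = F + Finsupp.single p 1
  · exfalso; apply hb
    subst h1
    rw [coeff_add, coeff_add, hc, coeff_monomial, coeff_monomial, if_pos rfl, if_neg]
    · rfl
    · intro h; exact hpq (hs _ _ (add_left_cancel h)).symm
  by_cases h2 : b = F + Finsupp.single q 1
  · exfalso; apply hb
    subst h2
    rw [coeff_add, coeff_add, hc, coeff_monomial, coeff_monomial, if_pos rfl, if_neg]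
    · rfl
    · intro h; exact hpq (hs _ _ (add_left_cancel h))
  rw [coeff_add, coeff_add, coeff_monomial, coeff_monomial, if_neg (Ne.symm h1), if_neg (Ne.symm h2),
    add_zero, add_zero] at hb
  obtain ⟨c, rfl, hcF⟩ := supp_sq _ _ _ hb
  have hc1 : mdeg c = 1 := by rw [mdeg_add] at hd; simpa using hd
  obtain ⟨j, hj⟩ : ∃ j, c = Finsupp.single j 1 := by
    have hne : c ≠ 0 := by rintro rfl; simp [mdeg] at hc1
    obtain ⟨j, hj⟩ := Finsupp.ne_iff.mp hne
    refine ⟨j, ?_⟩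
    simp only [Finsupp.coe_zero, Pi.zero_apply] at hj
    unfold mdeg at hc1
    rw [← Finset.add_sum_erase _ _ (Finset.mem_univ j)] at hc1
    have h0 : ∑ x ∈ Finset.univ.erase j, c x = 0 := by omega
    rw [Finset.sum_eq_zero_iff] at h0
    ext i
    by_cases hi : i = j
    · subst hi; simp; omega
    · rw [h0 i (by simp [hi]), Finsupp.single_apply, if_neg (Ne.symm hi)]
  subst hj
  apply Fk_lt p q j hpq
  · rintro rfl; exact h1 rfl
  · rintro rfl; exact h2 rfl

lemma deg_mdeg {n : ℕ} (F : Fin n →₀ ℕ) : F.degree = mdeg F := by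
  rw [Finsupp.degree_eq_sum]; rfl

lemma hc_mon {n : ℕ} (d : ℕ) (F : Fin n →₀ ℕ) :
    homogeneousComponent d (monomial F 1 : P n) = if d = mdeg F then monomial F 1 else 0 := by
  classical
  ext b
  rw [coeff_homogeneousComponent]
  split_ifs with h1 h2 h2
  · rfl
  · rw [coeff_monomial, if_neg, coeff_zero]
    rintro rfl; rw [deg_mdeg] at h1; exact h2 h1.symm
  · rw [coeff_monomial, if_neg]
    rintro rfl; rw [deg_mdeg] at h1; exact h1 h2.symm
  · rfl

lemma SqK_mon {n : ℕ} (k : ℕ) (F : Fin n →₀ ℕ) :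
    SqK n k (monomial F 1) = homogeneousComponent (mdeg F + k) (sqTot n (monomial F 1)) := by
  unfold SqK
  rw [Finset.sum_eq_single (mdeg F)]
  · rw [hc_mon, if_pos rfl]
  · intro b _ hb
    rw [hc_mon, if_neg hb]; simp
  · intro h
    exfalso; apply h
    rw [Finset.mem_range, totalDegree_monomial _ one_ne_zero]
    have : (F.sum fun _ e => e) = mdeg F := deg_mdeg F
    omega

lemma Good_mem {n : ℕ} (i s : ℕ) (F A B : Fin n →₀ ℕ) (h : Good i F A B) (his : i < s)
    (hA : mdeg A = mdeg F + 2 ^ i) (hB : mdeg B = mdeg F + 2 ^ i) :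
    (monomial A 1 + monomial B 1 : P n) ∈ AplusS n s ⊔ PnLt n (mdeg A) (wt A) := by
  set R : P n := sqTot n (monomial F 1) + monomial A 1 + monomial B 1 with hR
  have h1 : homogeneousComponent (mdeg A) R = SqK n (2 ^ i) (monomial F 1) + monomial A 1 + monomial B 1 := by
    rw [hR, map_add, map_add, hc_mon, hc_mon, if_pos rfl, if_pos (by omega), SqK_mon, hA]
  have h2 : (monomial A 1 + monomial B 1 : P n) = SqK n (2 ^ i) (monomial F 1) + homogeneousComponent (mdeg A) R := by
    rw [h1]
    linear_combination - two_zero (SqK n (2 ^ i) (monomial F 1))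
  rw [h2]
  apply Submodule.add_mem_sup
  · apply Submodule.subset_span
    exact ⟨2 ^ i, Nat.one_le_two_pow, Nat.pow_lt_pow_right (by norm_num) his, _, rfl⟩
  · rw [(homogeneousComponent (mdeg A) R).as_sum]
    apply Submodule.sum_mem
    intro b hb
    rw [mem_support_iff, coeff_homogeneousComponent] at hb
    have hb1 : b.degree = mdeg A := by by_contra h; rw [if_neg h] at hb; exact hb rfl
    rw [if_pos hb1] at hb
    rw [deg_mdeg] at hb1
    have : ∀ c : ZMod 2, (monomial b c : P n) = c • monomial b 1 := by
      intro c; rw [smul_monomial, smul_eq_mul, mul_one]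
    rw [this]
    apply Submodule.smul_mem
    apply Submodule.subset_span
    exact ⟨b, hb1, h b hb (by omega), rfl⟩

def SRel {n : ℕ} (s : ℕ) (x : Fin n →₀ ℕ) (l l' : List (Fin n)) : Prop :=
  l.length = l'.length ∧
    (monomial (Ee x l) 1 + monomial (Ee x l') 1 : P n) ∈ AplusS n s ⊔ PnLt n (mdeg (Ee x l)) (wt (Ee x l))

section rel
variable {n : ℕ} {s : ℕ} {x : Fin n →₀ ℕ}

lemma SRel.refl (l : List (Fin n)) : SRel s x l l := ⟨rfl, by rw [two_zero]; exact Submodule.zero_mem _⟩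

lemma SRel.symm {l l' : List (Fin n)} (h : SRel s x l l') : SRel s x l' l := by
  refine ⟨h.1.symm, ?_⟩
  rw [mdeg_Ee x l' l h.1.symm, wt_Ee x l' l h.1.symm, add_comm]
  exact h.2

lemma SRel.trans {l l' l'' : List (Fin n)} (h : SRel s x l l') (h' : SRel s x l' l'') : SRel s x l l'' := by
  refine ⟨h.1.trans h'.1, ?_⟩
  have h2 := h'.2
  rw [mdeg_Ee x l' l h.1.symm, wt_Ee x l' l h.1.symm] at h2
  have := Submodule.add_mem _ h.2 h2
  convert this using 1
  linear_combination - two_zero (monomial (Ee x l') 1 : P n)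

lemma Good_list (pre : List (Fin n)) (p q : Fin n) (hpq : p ≠ q) (z : Fin n →₀ ℕ) (k : ℕ) :
    Good pre.length (Ee (Fk p q z (k + 1)) pre) (Ee (Fk p q z (k + 1) + Finsupp.single p 1) pre)
      (Ee (Fk p q z (k + 1) + Finsupp.single q 1) pre) := by
  induction pre with
  | nil => exact Good_base p q hpq z k
  | cons c l ih => exact Good_step _ _ _ _ c ih

lemma mdeg_Ee_single (pre : List (Fin n)) (p : Fin n) (F : Fin n →₀ ℕ) :
    mdeg (Ee (F + Finsupp.single p 1) pre) = mdeg (Ee F pre) + 2 ^ pre.length := by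
  induction pre with
  | nil =>
    have : mdeg (Finsupp.single p 1 : Fin n →₀ ℕ) = 1 := by simp [mdeg, Finsupp.single_apply]
    simp [Ee, mdeg_add, this]
  | cons c l ih =>
    simp only [Ee, mdeg_add, mdeg_two, ih, List.length_cons, pow_succ]
    ring

lemma rel_base (pre W : List (Fin n)) (p q : Fin n) (hpq : p ≠ q) (k : ℕ) (hk : 1 ≤ k)
    (hs : pre.length < s) :
    SRel s x (pre ++ (List.replicate k p ++ q :: W)) (pre ++ (List.replicate k q ++ p :: W)) := by
  obtain ⟨k, rfl⟩ : ∃ m, k = m + 1 := ⟨k - 1, by omega⟩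
  refine ⟨by simp, ?_⟩
  rw [Ee_append x pre, Ee_append x pre, ← Fk_single p q hpq, ← Fk_single q p hpq.symm, Fk_symm q p]
  exact Good_mem _ _ _ _ _ (Good_list pre p q hpq _ k) hs (mdeg_Ee_single _ _ _) (mdeg_Ee_single _ _ _)

lemma rel_swap (pre W : List (Fin n)) (p q : Fin n) (hs : pre.length < s) :
    SRel s x (pre ++ p :: q :: W) (pre ++ q :: p :: W) := by
  by_cases hpq : p = q
  · subst hpq; exact SRel.refl _
  · exact rel_base pre W p q hpq 1 le_rfl hs

lemma rel_move (pre L W : List (Fin n)) (p : Fin n) (hs : pre.length + L.length ≤ s) :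
    SRel s x (pre ++ p :: (L ++ W)) (pre ++ (L ++ p :: W)) := by
  induction L generalizing pre with
  | nil => exact SRel.refl _
  | cons c L ih =>
    simp only [List.length_cons] at hs
    have h1 := rel_swap (s := s) (x := x) pre (L ++ W) p c (by omega)
    have h2 := ih (pre ++ [c]) (by simp; omega)
    simp only [List.append_assoc, List.cons_append, List.nil_append] at h2 ⊢
    exact h1.trans h2

/-- `(y, x^a, y, W) ~ (y, x^{a+1}, W)` -/
lemma rel_main (pre : List (Fin n)) (p q : Fin n) (hpq : p ≠ q) (hs : pre.length + 1 < s) (a : ℕ) (ha : 1 ≤ a) :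
    ∀ W : List (Fin n), SRel s x (pre ++ q :: (List.replicate a p ++ q :: W))
      (pre ++ q :: (List.replicate (a + 1) p ++ W)) := by
  induction a using Nat.strong_induction_on with
  | _ a ih =>
  intro W
  have B0 : ∀ (k : ℕ) (V : List (Fin n)) (c e : Fin n), c ≠ e → 1 ≤ k →
      SRel s x (pre ++ (List.replicate k c ++ e :: V)) (pre ++ (List.replicate k e ++ c :: V)) :=
    fun k V c e hce hk => rel_base pre V c e hce k hk (by omega)
  have B1 : ∀ (k : ℕ) (V : List (Fin n)) (f c e : Fin n), c ≠ e → 1 ≤ k →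
      SRel s x (pre ++ f :: (List.replicate k c ++ e :: V)) (pre ++ f :: (List.replicate k e ++ c :: V)) := by
    intro k V f c e hce hk
    have := rel_base (s := s) (x := x) (pre ++ [f]) V c e hce k hk (by simp; omega)
    simpa using this
  have e1 := B1 a W q p q hpq ha
  have e2 := B0 (a + 1) W q p hpq.symm (by omega)
  have e3 := B1 a W p p q hpq ha
  have e4 : SRel s x (pre ++ p :: (List.replicate a q ++ p :: W))
      (pre ++ q :: p :: (List.replicate (a - 1) q ++ p :: W)) := by
    obtain ⟨b, rfl⟩ : ∃ b, a = b + 1 := ⟨a - 1, by omega⟩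
    exact rel_swap pre _ p q (by omega)
  have e5 : ∀ j, j < a → SRel s x (pre ++ q :: p :: (List.replicate (a - 1) q ++ p :: W))
      (pre ++ q :: (List.replicate (j + 1) p ++ (List.replicate (a - 1 - j) q ++ p :: W))) := by
    intro j
    induction j with
    | zero => intro _; exact SRel.refl _
    | succ j ihj =>
      intro hj
      refine (ihj (by omega)).trans ?_
      obtain ⟨b, hb⟩ : ∃ b, a - 1 - j = b + 1 := ⟨a - 1 - j - 1, by omega⟩
      have hb' : a - 1 - (j + 1) = b := by omega
      rw [hb, hb']
      exact ih (j + 1) (by omega) (by omega) _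
  have e6 := e5 (a - 1) (by omega)
  have h7 : a - 1 + 1 = a := by omega
  rw [Nat.sub_self, h7] at e6
  have h8 : List.replicate (a + 1) p ++ W = List.replicate a p ++ p :: W := by
    rw [List.replicate_succ', List.append_assoc]; rfl
  rw [h8]
  rw [List.replicate_succ, List.replicate_succ] at e2
  exact e1.trans (e2.trans (e3.trans (e4.trans e6)))

lemma rel_main2 (pre : List (Fin n)) (p q : Fin n) (hpq : p ≠ q) (hs : pre.length + 1 < s) (a : ℕ) (ha : 1 ≤ a)
    (u : ℕ) : SRel s x (pre ++ q :: (List.replicate a p ++ List.replicate u q))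
      (pre ++ q :: List.replicate (a + u) p) := by
  induction u generalizing a with
  | zero => simpa using SRel.refl _
  | succ u ih =>
    have h1 := rel_main (s := s) (x := x) pre p q hpq hs a ha (List.replicate u q)
    have h2 := ih (a + 1) (by omega)
    rw [show a + 1 + u = a + (u + 1) by ring] at h2
    exact h1.trans h2

lemma rel_final (L : List (Fin n)) (p q : Fin n) (hpq : p ≠ q) (hq : q ∈ L) (hs : L.length < s)
    (a : ℕ) (ha : 1 ≤ a) (u : ℕ) :
    SRel s x (L ++ (List.replicate a p ++ List.replicate u q)) (L ++ List.replicate (a + u) p) := by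
  obtain ⟨L1, L2, rfl⟩ := List.append_of_mem hq
  simp only [List.length_append, List.length_cons] at hs
  have h1 := rel_move (s := s) (x := x) L1 L2 (List.replicate a p ++ List.replicate u q) q (by omega)
  have h2 := rel_move (s := s) (x := x) L1 L2 (List.replicate (a + u) p) q (by omega)
  have h3 := rel_main2 (s := s) (x := x) (L1 ++ L2) p q hpq (by simp; omega) a ha u
  simp only [List.append_assoc, List.cons_append] at h1 h2 h3 ⊢
  exact h1.trans (h3.trans h2.symm)

end rel

lemma Ee_replicate {n : ℕ} (z : Fin n →₀ ℕ) (e : ℕ) (c k : Fin n) :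
    Ee z (List.replicate e c) k = if k = c then 2 ^ e * z k else 2 ^ e - 1 + 2 ^ e * z k := by
  induction e with
  | zero => simp [Ee]
  | succ e ih =>
    simp only [List.replicate_succ, Ee, Finsupp.add_apply, Finsupp.smul_apply, ih, oneC, ev_apply, smul_eq_mul]
    have : 1 ≤ 2 ^ e := Nat.one_le_two_pow
    split_ifs
    · ring
    · rw [pow_succ]
      have : 2 ^ e * 2 * z k = 2 * (2 ^ e * z k) := by ring
      omega

/-- the list `top, top - 1, …, top - r + 1` (zero-based labels) -/
def Ld (n : ℕ) [NeZero n] : ℕ → ℕ → List (Fin n)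
  | _, 0 => []
  | top, r + 1 => Fin.ofNat n top :: Ld n (top - 1) r

lemma Ld_length (n : ℕ) [NeZero n] (top r : ℕ) : (Ld n top r).length = r := by
  induction r generalizing top with
  | zero => rfl
  | succ r ih => simp [Ld, ih]

lemma Ld_mem (n : ℕ) [NeZero n] (top r : ℕ) (c : Fin n) (h1 : (c : ℕ) ≤ top) (h2 : top < c + r) :
    c ∈ Ld n top r := by
  induction r generalizing top with
  | zero => omega
  | succ r ih =>
    simp only [Ld, List.mem_cons]
    by_cases h : (c : ℕ) = top
    · left; rw [← h]; simp
    · right; apply ih <;> omega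

lemma Ld_val (n : ℕ) [NeZero n] (z : Fin n →₀ ℕ) (top r : ℕ) (k : Fin n) (hr : r ≤ top) (htop : top < n) :
    Ee z (Ld n top r) k + (if top < k + r ∧ (k : ℕ) ≤ top then 2 ^ (top - k) else 0) =
      2 ^ r - 1 + 2 ^ r * z k := by
  induction r generalizing top with
  | zero =>
    rw [if_neg (by omega)]; simp [Ld, Ee]
  | succ r ih =>
    have h := ih (top - 1) (by omega) (by omega)
    simp only [Ld, Ee, Finsupp.add_apply, Finsupp.smul_apply, oneC, ev_apply, smul_eq_mul]
    have h1 : 1 ≤ 2 ^ r := Nat.one_le_two_pow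
    have h3 : 2 ^ (r + 1) * z k = 2 * (2 ^ r * z k) := by ring
    have h4 : 2 ^ (r + 1) = 2 * 2 ^ r := by ring
    have h5 : k = Fin.ofNat n top ↔ (k : ℕ) = top := by
      rw [Fin.ext_iff]; simp [Nat.mod_eq_of_lt htop]
    simp only [h5]
    by_cases hk : (k : ℕ) = top
    · rw [if_neg (by omega)] at h
      rw [if_pos hk, if_pos (by omega), hk, Nat.sub_self, pow_zero]
      omega
    · rw [if_neg hk]
      by_cases hk2 : top < k + (r + 1) ∧ (k : ℕ) ≤ top
      · rw [if_pos (by omega)] at h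
        rw [if_pos hk2]
        have h6 : 2 ^ (top - k) = 2 * 2 ^ (top - 1 - k) := by
          rw [← pow_succ']; congr 1; omega
        omega
      · rw [if_neg (by omega)] at h
        rw [if_neg hk2]
        omega

lemma sort_Icc (t n : ℕ) : (Finset.Icc (t + 1) n).sort (· ≤ ·) = List.range' (t + 1) (n - t) := by
  have : (Finset.Icc (t + 1) n).sort (· ≤ ·) = (List.range' (t + 1) (n + 1 - (t + 1))).mergeSort (· ≤ ·) := rfl
  rw [this, show n + 1 - (t + 1) = n - t by omega]
  apply List.mergeSort_eq_self
  exact List.pairwise_le_range'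

lemma getD_range' (t m j : ℕ) (h : j < m) : (List.range' (t + 1) m).getD j 0 = t + 1 + j := by
  simp [List.getD, h]

lemma nuE_X (m e k : ℕ) (h : k - 1 < m) : nuE (Xexp m e) k = e := by
  simp [nuE, h, Xexp, ev_apply]

lemma compat (n t e u : ℕ) (ht : 0 < t) (htn : t < n) (he : n - t < e) :
    uCompat (List.range' (t + 1) (n - t)) u (Xexp (n - 1) (2 ^ e - 1)) ↔ u = 1 := by
  have hne : List.range' (t + 1) (n - t) ≠ [] := by
    intro h; have := congrArg List.length h; simp at this; omega
  unfold uCompat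
  rw [if_neg hne]
  simp only [List.length_range']
  have hnu : ∀ j, 1 ≤ j → j ≤ n - t →
      nuE (Xexp (n - 1) (2 ^ e - 1)) ((List.range' (t + 1) (n - t)).getD (j - 1) 0 - 1) = 2 ^ e - 1 := by
    intro j h1 h2
    rw [getD_range' _ _ _ (by omega), nuE_X _ _ _ (by omega)]
  have hlt : 2 ^ (n - t) < 2 ^ e := Nat.pow_lt_pow_right (by norm_num) he
  have hpos : 1 ≤ 2 ^ (n - t) := Nat.one_le_two_pow
  constructor
  · rintro ⟨h1, h2, h3, -⟩
    by_contra hu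
    have := h3 1 le_rfl (by omega)
    rw [hnu 1 le_rfl (by omega)] at this
    omega
  · rintro rfl
    refine ⟨le_rfl, by omega, by intro j h1 h2; omega, ?_, ?_, ?_⟩
    · rw [hnu 1 le_rfl (by omega)]; omega
    · intro j h1 h2
      rw [hnu 1 le_rfl (by omega), Nat.testBit_two_pow_sub_one]; simp; omega
    · intro j h1 h2
      rw [hnu j (by omega) h2, Nat.testBit_two_pow_sub_one]; simp; omega

lemma fIdx_inj (n i : ℕ) : Function.Injective (fIdx n i) := by
  intro a b h
  unfold fIdx at h
  ext
  split_ifs at h <;> simp [Fin.ext_iff] at h <;> omega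

lemma mapD (n t e : ℕ) (ht : 0 < t) (htn : t < n) (k : Fin n) :
    Finsupp.mapDomain (fIdx n t) (Xexp (n - 1) e) k = if (k : ℕ) + 1 = t then 0 else e := by
  split_ifs with h
  · apply Finsupp.mapDomain_of_notMem_range
    rintro ⟨j, hj⟩
    unfold fIdx at hj
    split_ifs at hj <;> simp [Fin.ext_iff] at hj <;> omega
  · have : ∃ j, fIdx n t j = k := by
      have := k.isLt
      by_cases hk : (k : ℕ) + 1 < t
      · exact ⟨⟨k, by omega⟩, by unfold fIdx; rw [if_pos (by simpa using hk)]⟩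
      · refine ⟨⟨k - 1, by omega⟩, ?_⟩
        unfold fIdx
        rw [if_neg]
        · simp [Fin.ext_iff]; omega
        · simp; omega
    obtain ⟨j, rfl⟩ := this
    rw [Finsupp.mapDomain_apply (fIdx_inj n t)]
    rfl

lemma xIu (n t : ℕ) (ht : 0 < t) (htn : t < n) (k : Fin n) :
    xIuExp n (List.range' (t + 1) (n - t)) 1 k = if t ≤ (k : ℕ) then 2 ^ (n - 1 - k) else 0 := by
  unfold xIuExp
  simp only [List.length_range']
  have hk := k.isLt
  rw [getD_range' _ _ _ (by omega)]
  have hsum : ∑ τ ∈ Finset.Icc (1 + 1) (n - t), (if (List.range' (t + 1) (n - t)).getD (τ - 1) 0 = (k : ℕ) + 1 then 2 ^ (n - t - τ) else 0)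
      = if t < (k : ℕ) then 2 ^ (n - 1 - k) else 0 := by
    have h1 : ∀ τ ∈ Finset.Icc (1 + 1) (n - t), (if (List.range' (t + 1) (n - t)).getD (τ - 1) 0 = (k : ℕ) + 1 then 2 ^ (n - t - τ) else 0)
      = if τ = k + 1 - t then (if t < (k : ℕ) then 2 ^ (n - 1 - k) else 0) else 0 := by
      intro τ hτ
      rw [Finset.mem_Icc] at hτ
      rw [getD_range' _ _ _ (by omega)]
      by_cases h : τ = k + 1 - t
      · rw [if_pos (by omega), if_pos h, if_pos (by omega)]; congr 1; omega
      · rw [if_neg (by omega), if_neg h]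
    rw [Finset.sum_congr rfl h1, Finset.sum_ite_eq']
    by_cases h : t < (k : ℕ)
    · rw [if_pos (by rw [Finset.mem_Icc]; omega)]
    · simp [h]
  rw [hsum]
  rcases lt_trichotomy t (k : ℕ) with h | h | h
  · rw [if_neg (by omega), if_pos h, if_pos h.le, zero_add]
  · rw [if_pos (by omega), if_neg (by omega), if_pos h.le, ← h]
    have : 2 ^ (n - t) = 2 * 2 ^ (n - 1 - t) := by rw [← pow_succ']; congr 1; omega
    rw [this, show n - t - 1 = n - 1 - t by omega]; omega
  · rw [if_neg (by omega), if_neg (by omega), if_neg (by omega)]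

lemma phi_eq (n t e : ℕ) (ht : 0 < t) (htn : t < n) (he : n - t < e) :
    phiMon n t ((Finset.Icc (t + 1) n).sort (· ≤ ·)) (Xexp (n - 1) (2 ^ e - 1)) =
      monomial (ev fun k : Fin n => if (k : ℕ) + 1 = t then 2 ^ (n - t) - 1 else
        2 ^ e - 1 - if t ≤ (k : ℕ) then 2 ^ (n - 1 - k) else 0) 1 := by
  rw [sort_Icc]
  have h : ∃ u, uCompat (List.range' (t + 1) (n - t)) u (Xexp (n - 1) (2 ^ e - 1)) :=
    ⟨1, (compat n t e 1 ht htn he).mpr rfl⟩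
  unfold phiMon
  rw [dif_pos h, (compat n t e _ ht htn he).mp (Classical.choose_spec h)]
  congr 2
  ext k
  rw [ev_apply, ev_apply, mapD n t _ ht htn, xIu n t ht htn, List.length_range']
  by_cases hk : (k : ℕ) + 1 = t
  · rw [if_pos hk, if_pos hk, if_pos hk, if_neg (by omega)]; omega
  · rw [if_neg hk, if_neg hk, if_neg hk, zero_add]

/-- Proposition 3.10: let `1 ≤ u`, `u < d − n + t` (stated integrally as
`u + n < d + t`), `0 < t < h ≤ n`, let `x` be any monomial of `P_n`, and let
`Z = φ_{(t;I_t)}(X^{2^{d−u}−1}) · X_h^{2^d − 2^{d−u}} · x^{2^d}`, a monomial of `P_n`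
with exponent vector `a`.  Then `Z + φ_{(t;I_t)}(X^{2^d−1}) · x^{2^d}
∈ A_{n−t+1}^+P_n + P_n^−(ω(Z))`. -/
theorem statement11 (n d h t u : ℕ) (hu : 1 ≤ u) (hud : u + n < d + t)
    (ht : 0 < t) (hth : t < h) (hhn : h ≤ n) (x : Fin n →₀ ℕ) (a : Fin n →₀ ℕ)
    (hZ : (monomial a 1 : P n) =
      phiMon n t ((Finset.Icc (t + 1) n).sort (· ≤ ·)) (Xexp (n - 1) (2 ^ (d - u) - 1))
        * XjMon n h (2 ^ d - 2 ^ (d - u)) * monomial (2 ^ d • x) 1) :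
    (monomial a 1 : P n)
      + phiMon n t ((Finset.Icc (t + 1) n).sort (· ≤ ·)) (Xexp (n - 1) (2 ^ d - 1))
        * monomial (2 ^ d • x) 1
    ∈ AplusS n (n - t + 1) ⊔ PnLt n (mdeg a) (wt a) := by
  have hn : NeZero n := ⟨by omega⟩
  set L := Ld n (n - 1) (n - t) with hL
  have hLl : L.length = n - t := Ld_length _ _ _
  set p : Fin n := ⟨t - 1, by omega⟩ with hp
  set q : Fin n := ⟨h - 1, by omega⟩ with hq
  have hpq : p ≠ q := by simp [hp, hq]; omega
  have hqL : q ∈ L := Ld_mem _ _ _ _ (by simp [hq]; omega) (by simp [hq]; omega)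
  obtain ⟨f, hf⟩ : ∃ f, d - u = (n - t) + f := ⟨d - u - (n - t), by omega⟩
  have hd : d = (n - t) + f + u := by omega
  have hrel := rel_final (s := n - t + 1) (x := x) L p q hpq hqL (by omega) f (by omega) u
  have hA : 1 ≤ 2 ^ (n - t) := Nat.one_le_two_pow
  have hB : 1 ≤ 2 ^ f := Nat.one_le_two_pow
  have hC : 1 ≤ 2 ^ u := Nat.one_le_two_pow
  have h2 : phiMon n t ((Finset.Icc (t + 1) n).sort (· ≤ ·)) (Xexp (n - 1) (2 ^ d - 1))
        * monomial (2 ^ d • x) 1 = monomial (Ee x (L ++ List.replicate (f + u) p)) 1 := by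
    rw [phi_eq n t d ht (by omega) (by omega), monomial_mul, mul_one]
    congr 2
    ext k
    have hk := k.isLt
    have h3 := Ld_val n (Ee x (List.replicate (f + u) p)) (n - 1) (n - t) k (by omega) (by omega)
    rw [Ee_replicate] at h3
    have hkp : k = p ↔ (k : ℕ) + 1 = t := by rw [Fin.ext_iff, hp]; simp; omega
    have hcond : (n - 1 < (k : ℕ) + (n - t) ∧ (k : ℕ) ≤ n - 1) ↔ t ≤ (k : ℕ) := by omega
    simp only [hkp, hcond] at h3
    rw [← hL] at h3
    rw [Ee_append]
    simp only [Finsupp.add_apply, Finsupp.smul_apply, ev_apply, smul_eq_mul]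
    have e1 : 2 ^ d = 2 ^ (n - t) * 2 ^ (f + u) := by rw [← pow_add]; congr 1; omega
    have e2 : 2 ^ (n - t) * (2 ^ (f + u) * x k) = 2 ^ d * x k := by rw [e1]; ring
    have e3 : 2 ^ (n - t) * (2 ^ (f + u) - 1 + 2 ^ (f + u) * x k) + 2 ^ (n - t) = 2 ^ d + 2 ^ d * x k := by
      have : 1 ≤ 2 ^ (f + u) := Nat.one_le_two_pow
      obtain ⟨m, hm⟩ := Nat.exists_eq_add_of_le this
      rw [e1, hm, Nat.add_sub_cancel_left]; ring
    have e4 : 2 ^ (n - t) ≤ 2 ^ d := Nat.pow_le_pow_right (by norm_num) (by omega)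
    clear e1
    by_cases hkt : (k : ℕ) + 1 = t
    · rw [if_pos hkt, if_neg (by omega), e2] at h3
      rw [if_pos hkt]
      omega
    · rw [if_neg hkt] at h3
      rw [if_neg hkt]
      by_cases hkt' : t ≤ (k : ℕ)
      · rw [if_pos hkt'] at h3 ⊢
        have e5 : 2 ^ (n - 1 - (k : ℕ)) < 2 ^ d := Nat.pow_lt_pow_right (by norm_num) (by omega)
        omega
      · rw [if_neg hkt'] at h3 ⊢
        omega
  have h1 : a = Ee x (L ++ (List.replicate f p ++ List.replicate u q)) := by
    rw [phi_eq n t (d - u) ht (by omega) (by omega), XjMon, monomial_mul, monomial_mul, mul_one, mul_one] at hZ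
    have ha := monomial_left_injective (R := ZMod 2) one_ne_zero hZ
    rw [ha]
    ext k
    have hk := k.isLt
    have h3 := Ld_val n (Ee x (List.replicate f p ++ List.replicate u q)) (n - 1) (n - t) k (by omega) (by omega)
    rw [Ee_append x, Ee_replicate, Ee_replicate] at h3
    have hkp : k = p ↔ (k : ℕ) + 1 = t := by rw [Fin.ext_iff, hp]; simp; omega
    have hkq : k = q ↔ (k : ℕ) + 1 = h := by rw [Fin.ext_iff, hq]; simp; omega
    have hcond : (n - 1 < (k : ℕ) + (n - t) ∧ (k : ℕ) ≤ n - 1) ↔ t ≤ (k : ℕ) := by omega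
    simp only [hkp, hkq, hcond] at h3
    rw [← hL] at h3
    rw [Ee_append, Ee_append]
    simp only [Finsupp.add_apply, Finsupp.smul_apply, ev_apply, smul_eq_mul]
    have e0 : 2 ^ d = 2 ^ (n - t) * 2 ^ f * 2 ^ u := by rw [← pow_add, ← pow_add]; congr 1
    have e1 : 2 ^ (d - u) = 2 ^ (n - t) * 2 ^ f := by rw [← pow_add]; congr 1
    have e4 : 2 ^ (n - t) ≤ 2 ^ (d - u) := Nat.pow_le_pow_right (by norm_num) (by omega)
    have e5 : 2 ^ (d - u) ≤ 2 ^ d := Nat.pow_le_pow_right (by norm_num) (by omega)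
    obtain ⟨B, hB'⟩ := Nat.exists_eq_add_of_le hB
    obtain ⟨D, hD'⟩ := Nat.exists_eq_add_of_le hC
    have i1 : 2 ^ (n - t) * (2 ^ f * (2 ^ u - 1 + 2 ^ u * x k)) + 2 ^ (d - u) = 2 ^ d + 2 ^ d * x k := by
      rw [e0, e1, hD', Nat.add_sub_cancel_left]; ring
    have i2 : 2 ^ (n - t) * (2 ^ f - 1 + 2 ^ f * (2 ^ u * x k)) + 2 ^ (n - t) = 2 ^ (d - u) + 2 ^ d * x k := by
      rw [e0, e1, hB', Nat.add_sub_cancel_left]; ring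
    have i3 : 2 ^ (n - t) * (2 ^ f - 1 + 2 ^ f * (2 ^ u - 1 + 2 ^ u * x k)) + 2 ^ (n - t) = 2 ^ d + 2 ^ d * x k := by
      rw [e0, hB', hD', Nat.add_sub_cancel_left, Nat.add_sub_cancel_left]; ring
    clear e0 e1
    by_cases hkt : (k : ℕ) + 1 = t
    · rw [if_pos hkt, if_neg (by omega), if_neg (by omega)] at h3
      rw [if_pos hkt, if_neg (by omega)]
      omega
    · rw [if_neg hkt] at h3
      rw [if_neg hkt]
      by_cases hkt' : t ≤ (k : ℕ)
      · have e6 : 2 ^ (n - 1 - (k : ℕ)) < 2 ^ (d - u) := Nat.pow_lt_pow_right (by norm_num) (by omega)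
        rw [if_pos hkt'] at h3 ⊢
        by_cases hkh : (k : ℕ) + 1 = h
        · rw [if_pos hkh] at h3 ⊢
          omega
        · rw [if_neg hkh] at h3 ⊢
          omega
      · rw [if_neg hkt', if_neg (by omega)] at h3
        rw [if_neg hkt', if_neg (by omega)]
        omega
  rw [h2, h1]
  exact hrel.2
end
end

section
/- Let n ≥ 2, let t be an integer with 1 < t ≤ n, let d be an integer with d > n − t + 1, set Y_t = Σ_{u=t}^{n} φ_{(t;I_t)}(X^{2^d−1}) x_u^{2^d}, and let ω be the weight vector with ω_i = n−1 for 1 ≤ i ≤ d, ω_{d+1} = 1, ω_i = 0 for i > d+1. Then there exists a finite set S of pairs (j;J) ∈ N_n with 1 ≤ j < t, J a subsequence of I_{t−1} = (t, t+1, …, n) with J ≠ I_{t−1}, such that Y_t + Σ_{(j;J)∈S} φ_{(j;J)}(X^{2^d−1}) x_j^{2^d} ∈ A_{n−t+1}^+P_n + P_n^−(ω). -/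
open MvPolynomial

noncomputable section

namespace St

lemma two_zero {n : ℕ} (f : P n) : f + f = 0 := CharTwo.add_self_eq_zero f

lemma degree_eq {n : ℕ} (a : Fin n →₀ ℕ) : a.degree = mdeg a := by
  simp [mdeg, Finsupp.degree_eq_sum]

lemma hc_monomial {n : ℕ} (e : ℕ) (a : Fin n →₀ ℕ) (c : ZMod 2) :
    homogeneousComponent e (monomial a c : P n) = if mdeg a = e then monomial a c else 0 := by
  rw [homogeneousComponent_of_mem (m := e) (n := mdeg a)]
  · simp [eq_comm]
  · exact isHomogeneous_monomial c (degree_eq a)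

lemma SqK_eq {n : ℕ} (k N : ℕ) (f : P n) (hN : f.totalDegree < N) :
    SqK n k f = ∑ d ∈ Finset.range N,
      homogeneousComponent (d + k) (sqTot n (homogeneousComponent d f)) := by
  unfold SqK
  apply Finset.sum_subset
  · intro x; simp; omega
  · intro x _ hx
    rw [homogeneousComponent_eq_zero x f (by simp at hx; omega)]
    simp

lemma SqK_add {n : ℕ} (k : ℕ) (f g : P n) : SqK n k (f + g) = SqK n k f + SqK n k g := by
  set N := f.totalDegree + g.totalDegree + (f + g).totalDegree + 1
  rw [SqK_eq k N f (by omega), SqK_eq k N g (by omega), SqK_eq k N (f + g) (by omega),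
    ← Finset.sum_add_distrib]
  simp

lemma SqK_monomial {n : ℕ} (k : ℕ) (a : Fin n →₀ ℕ) :
    SqK n k (monomial a 1) = homogeneousComponent (mdeg a + k) (sqTot n (monomial a 1)) := by
  rw [SqK_eq k (max (mdeg a) (monomial a (1 : ZMod 2)).totalDegree + 1) _ (by omega)]
  rw [Finset.sum_eq_single (mdeg a)]
  · simp [hc_monomial]
  · intro b _ hb
    rw [hc_monomial, if_neg hb.symm]; simp
  · intro h; simp at h

lemma SqK_mem {n : ℕ} (k : ℕ) (V : Submodule (ZMod 2) (P n))
    (h : ∀ a, SqK n k (monomial a 1) ∈ V) (f : P n) : SqK n k f ∈ V := by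
  induction f using MvPolynomial.monomial_add_induction_on with
  | C c =>
    have : c = 0 ∨ c = 1 := by revert c; decide
    rcases this with rfl | rfl
    · simp [SqK]
    · exact h 0
  | monomial_add a b f _ _ ih =>
    rw [SqK_add]
    refine V.add_mem ?_ ih
    have : b = 0 ∨ b = 1 := by revert b; decide
    rcases this with rfl | rfl
    · simp [SqK]
    · exact h a

lemma AplusS_le {n s : ℕ} (V : Submodule (ZMod 2) (P n))
    (h : ∀ j, 1 ≤ j → j < 2 ^ s → ∀ a, SqK n j (monomial a 1) ∈ V) : AplusS n s ≤ V := by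
  unfold AplusS
  rw [Submodule.span_le]
  rintro _ ⟨j, h1, h2, f, rfl⟩
  exact SqK_mem j V (h j h1 h2) f

lemma AplusS_mono {n s s' : ℕ} (h : s ≤ s') : AplusS n s ≤ AplusS n s' := by
  apply Submodule.span_mono
  rintro _ ⟨j, h1, h2, f, rfl⟩
  exact ⟨j, h1, h2.trans_le (Nat.pow_le_pow_right (by norm_num) h), f, rfl⟩

/-- lower-weight monomials of any degree -/
def Q (n : ℕ) (w : ℕ → ℕ) : Submodule (ZMod 2) (P n) :=
  Submodule.span (ZMod 2) {p | ∃ a : Fin n →₀ ℕ, lexLt (wt a) w ∧ p = monomial a 1}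

lemma Q_hc {n : ℕ} {w : ℕ → ℕ} {f : P n} (hf : f ∈ Q n w) (D : ℕ) :
    homogeneousComponent D f ∈ PnLt n D w := by
  have : Q n w ≤ (PnLt n D w).comap (homogeneousComponent D) := by
    unfold Q
    rw [Submodule.span_le]
    rintro _ ⟨a, ha, rfl⟩
    simp only [Submodule.comap_coe, Set.mem_preimage, SetLike.mem_coe, hc_monomial]
    split_ifs with h
    · exact Submodule.subset_span ⟨a, h, ha, rfl⟩
    · exact zero_mem _
  exact this hf

lemma PnLt_le {n D : ℕ} {w : ℕ → ℕ} : PnLt n D w ≤ Q n w := by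
  apply Submodule.span_mono
  rintro _ ⟨a, _, ha, rfl⟩
  exact ⟨a, ha, rfl⟩

lemma AplusS_hc {n s : ℕ} {f : P n} (hf : f ∈ AplusS n s) (D : ℕ) :
    homogeneousComponent D f ∈ AplusS n s := by
  have : AplusS n s ≤ (AplusS n s).comap (homogeneousComponent D) := by
    apply AplusS_le
    intro j h1 h2 a
    simp only [Submodule.mem_comap]
    have hm : SqK n j (monomial a 1) ∈ AplusS n s := Submodule.subset_span ⟨j, h1, h2, _, rfl⟩
    rw [homogeneousComponent_of_mem (m := D) (n := mdeg a + j)]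
    · split_ifs
      · exact hm
      · exact zero_mem _
    · rw [SqK_monomial]; exact homogeneousComponent_mem _ _
  exact this hf

/-- the working submodule -/
def K (n s d : ℕ) : Submodule (ZMod 2) (P n) := AplusS n s ⊔ Q n (wSpike n d)

lemma K_mono {n s s' d : ℕ} (h : s ≤ s') : K n s d ≤ K n s' d :=
  sup_le_sup_right (AplusS_mono h) _

lemma final {n s d D : ℕ} {f : P n} (hf : f ∈ K n s d) (hD : f.IsHomogeneous D) :
    f ∈ AplusS n s ⊔ PnLt n D (wSpike n d) := by
  obtain ⟨x, hx, y, hy, rfl⟩ := Submodule.mem_sup.1 hf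
  have := homogeneousComponent_eq_self hD
  rw [← this, map_add]
  exact Submodule.add_mem_sup (AplusS_hc hx D) (Q_hc hy D)

lemma mon_mul {n : ℕ} (v w : Fin n → ℕ) :
    (monomial (ev v) 1 : P n) * monomial (ev w) 1 = monomial (ev fun k => v k + w k) 1 := by
  rw [monomial_mul, one_mul, show ev v + ev w = ev fun k => v k + w k from by
    ext k; simp [ev]]

lemma mon_pow {n : ℕ} (v : Fin n → ℕ) (e : ℕ) :
    (monomial (ev v) 1 : P n) ^ e = monomial (ev fun k => e * v k) 1 := by
  rw [monomial_pow, one_pow, show e • ev v = ev fun k => e * v k from by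
    ext k; simp [ev]]

lemma ev_app {n : ℕ} (v : Fin n → ℕ) (k) : ev v k = v k := rfl

lemma ev_self {n : ℕ} (a : Fin n →₀ ℕ) : ev (fun k => a k) = a := by ext k; rfl

/-- monomials with few odd exponents -/
def O (n N : ℕ) : Submodule (ZMod 2) (P n) :=
  Submodule.span (ZMod 2) {p | ∃ a : Fin n →₀ ℕ, wt a 0 < N ∧ p = monomial a 1}

lemma O_le {n d : ℕ} (hd : 0 < d) : O n (n - 1) ≤ Q n (wSpike n d) := by
  apply Submodule.span_mono
  rintro _ ⟨a, ha, rfl⟩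
  exact ⟨a, ⟨0, by simp, by simpa [wSpike, hd] using ha⟩, rfl⟩

lemma O_mul_sq {n N : ℕ} {f : P n} (hf : f ∈ O n N) (g : P n) : f * g ^ 2 ∈ O n N := by
  have : O n N ≤ (O n N).comap (LinearMap.mulRight (ZMod 2) (g ^ 2)) := by
    unfold O
    rw [Submodule.span_le]
    rintro _ ⟨a, ha, rfl⟩
    simp only [Submodule.comap_coe, Set.mem_preimage, SetLike.mem_coe, LinearMap.mulRight_apply]
    have key : ∀ b : Fin n →₀ ℕ, ∀ c : ZMod 2, (monomial a 1 : P n) * (monomial b c) ^ 2 ∈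
        Submodule.span (ZMod 2) {p : P n | ∃ a : Fin n →₀ ℕ, wt a 0 < N ∧ p = monomial a 1} := by
      intro b c
      have : c = 0 ∨ c = 1 := by revert c; decide
      rcases this with rfl | rfl
      · simp
      · refine Submodule.subset_span ⟨a + 2 • b, ?_, ?_⟩
        · convert ha using 1
          simp [wt]
        · rw [monomial_pow, monomial_mul]; simp
    induction g using MvPolynomial.monomial_add_induction_on with
    | C c => exact key 0 c
    | monomial_add b c f _ _ ih =>
      rw [CharTwo.add_sq, mul_add]
      exact Submodule.add_mem _ (key b c) ih
  exact this hf

lemma Q_hc' {n : ℕ} {w : ℕ → ℕ} {f : P n} (hf : f ∈ Q n w) (D : ℕ) :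
    homogeneousComponent D f ∈ Q n w := PnLt_le (Q_hc hf D)

lemma hc_mon_mul {n : ℕ} (e k : ℕ) (a : Fin n →₀ ℕ) (ha : mdeg a = e) (G : P n) :
    homogeneousComponent (e + k) (monomial a 1 * G) = monomial a 1 * homogeneousComponent k G := by
  have hd : ∀ b, mdeg (a + b) = e + mdeg b := by
    intro b; rw [← ha]; simp [mdeg, Finset.sum_add_distrib]
  induction G using MvPolynomial.monomial_add_induction_on with
  | C c =>
    rw [show (C c : P n) = monomial 0 c from rfl, monomial_mul, hc_monomial, hc_monomial, hd]
    simp only [add_right_inj]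
    split_ifs
    · rw [monomial_mul]
    · simp
  | monomial_add b c f _ _ ih =>
    rw [mul_add, map_add, map_add, mul_add, ih, monomial_mul, hc_monomial, hc_monomial, hd]
    simp only [add_right_inj]
    split_ifs <;> simp [monomial_mul]

lemma hc_sq {n : ℕ} (k : ℕ) (G : P n) :
    homogeneousComponent (2 * k) (G ^ 2) = (homogeneousComponent k G) ^ 2 := by
  have hd : ∀ b : Fin n →₀ ℕ, mdeg (2 • b) = 2 * mdeg b := by
    intro b; simp [mdeg, Finset.mul_sum]
  have key : ∀ (b : Fin n →₀ ℕ) (c : ZMod 2), homogeneousComponent (2 * k) ((monomial b c : P n) ^ 2) =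
      (homogeneousComponent k (monomial b c : P n)) ^ 2 := by
    intro b c
    rw [monomial_pow, hc_monomial, hc_monomial, hd]
    by_cases h : mdeg b = k
    · simp [h, monomial_pow]
    · rw [if_neg (by omega), if_neg h]; simp
  induction G using MvPolynomial.monomial_add_induction_on with
  | C c => exact key 0 c
  | monomial_add b c f _ _ ih =>
    rw [CharTwo.add_sq, map_add, map_add, CharTwo.add_sq, ih, key]

lemma sum_ind {n a : ℕ} (h1 : 1 ≤ a) (h2 : a ≤ n) :
    (∑ k : Fin n, if (k : ℕ) + 1 = a then 1 else 0) = 1 := by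
  rw [Finset.sum_eq_single (⟨a - 1, by omega⟩ : Fin n)]
  · simp; omega
  · intro b _ hb
    rw [if_neg]
    intro h; apply hb; ext; simp; omega
  · simp

end St
namespace St

lemma monE {n : ℕ} (v : Fin n → ℕ) : (monomial (ev v) 1 : P n) = ∏ k, X k ^ v k := by
  rw [monomial_eq, C_1, one_mul, Finsupp.prod_fintype]
  · rfl
  · simp

lemma sqTot_mon {n : ℕ} (v : Fin n → ℕ) :
    sqTot n (monomial (ev v) 1) = ∏ k, (X k + X k ^ 2) ^ v k := by
  rw [monE]; simp [sqTot]

lemma wt_Xj {n a : ℕ} (h1 : 1 ≤ a) (h2 : a ≤ n) :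
    ∑ k : Fin n, (if (k : ℕ) + 1 = a then 0 else 1) = n - 1 := by
  have h : ∑ k : Fin n, ((if (k : ℕ) + 1 = a then 0 else 1) + (if (k : ℕ) + 1 = a then 1 else 0)) = n := by
    rw [Finset.sum_congr rfl (g := fun _ => 1)]
    · simp
    · intro k _; split_ifs <;> rfl
  rw [Finset.sum_add_distrib, sum_ind h1 h2] at h
  omega

lemma sqTot_Xj {n a : ℕ} (h1 : 1 ≤ a) (h2 : a ≤ n) :
    ∃ R ∈ O n (n - 1), sqTot n (XjMon n a 1) = XjMon n a 1 + R := by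
  classical
  set A : Finset (Fin n) := Finset.univ.filter (fun k => ¬ ((k : ℕ) + 1 = a)) with hA
  have hcard : A.card = n - 1 := by
    rw [hA, Finset.card_filter, ← wt_Xj h1 h2]
    apply Finset.sum_congr rfl
    intro k _
    split_ifs <;> simp_all
  have e1 : XjMon n a 1 = ∏ k ∈ A, X k := by
    rw [XjMon, monE, hA, Finset.prod_filter]
    apply Finset.prod_congr rfl
    intro k _
    split_ifs <;> simp_all
  have e2 : sqTot n (XjMon n a 1) = ∏ k ∈ A, (X k + X k ^ 2) := by
    rw [e1]; simp [sqTot]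
  rw [e2, Finset.prod_add, e1]
  rw [← Finset.sum_erase_add _ _ (Finset.mem_powerset_self A)]
  refine ⟨_, ?_, by simp only [Finset.sdiff_self, Finset.prod_empty, mul_one]; rw [add_comm]⟩
  apply Submodule.sum_mem
  intro t ht
  rw [Finset.mem_erase, Finset.mem_powerset] at ht
  refine Submodule.subset_span ⟨ev fun k => if k ∈ t then 1 else if k ∈ A then 2 else 0, ?_, ?_⟩
  · have : t.card < A.card := Finset.card_lt_card (lt_of_le_of_ne ht.2 ht.1)
    have h2 : wt (ev fun k => if k ∈ t then 1 else if k ∈ A then 2 else 0) 0 = t.card := by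
      simp only [wt, ev_app, pow_zero, Nat.div_one]
      rw [Finset.card_eq_sum_ones, ← Finset.sum_subset (Finset.subset_univ t)]
      · apply Finset.sum_congr rfl; intro k hk; simp [hk]
      · intro k _ hk; simp only [hk, if_false]; split_ifs <;> rfl
    omega
  · rw [monE]
    have hAt : A = t ∪ (A \ t) := by rw [Finset.union_sdiff_of_subset ht.2]
    rw [← Finset.prod_subset (Finset.subset_univ A)]
    · conv_rhs => rw [hAt]
      rw [Finset.prod_union Finset.disjoint_sdiff]
      congr 1
      · apply Finset.prod_congr rfl; intro k hk; simp [hk]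
      · apply Finset.prod_congr rfl; intro k hk
        rw [Finset.mem_sdiff] at hk
        simp [hk.1, hk.2]
    · intro k _ hk
      have : k ∉ t := fun h => hk (ht.2 h)
      simp [hk, this]

lemma liftQ1 {n a d i : ℕ} (h1 : 1 ≤ a) (h2 : a ≤ n) (b : Fin n →₀ ℕ)
    (hi1 : ∀ j, j < i → wt b j = wSpike n d j) (hi2 : wt b i < wSpike n d i) :
    XjMon n a 1 * (monomial b 1) ^ 2 ∈ Q n (wSpike n (d + 1)) := by
  refine Submodule.subset_span
    ⟨ev fun k : Fin n => (if (k : ℕ) + 1 = a then 0 else 1) + 2 * b k, ?_, ?_⟩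
  · have w0 : wt (ev fun k : Fin n => (if (k : ℕ) + 1 = a then 0 else 1) + 2 * b k) 0 = n - 1 := by
      rw [← wt_Xj h1 h2]
      simp only [wt, ev_app]
      apply Finset.sum_congr rfl
      intro k _; split_ifs <;> simp
    have w1 : ∀ i, wt (ev fun k : Fin n => (if (k : ℕ) + 1 = a then 0 else 1) + 2 * b k) (i + 1)
        = wt b i := by
      intro i
      simp only [wt, ev_app]
      apply Finset.sum_congr rfl
      intro k _
      rw [pow_succ', ← Nat.div_div_eq_div_mul]
      congr 2
      split_ifs <;> omega
    have s0 : wSpike n (d + 1) 0 = n - 1 := by simp [wSpike]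
    have s1 : ∀ i, wSpike n (d + 1) (i + 1) = wSpike n d i := by intro i; simp [wSpike]
    refine ⟨i + 1, ?_, ?_⟩
    · intro j hj
      cases j with
      | zero => rw [w0, s0]
      | succ j => rw [w1, s1]; exact hi1 j (by omega)
    · rw [w1, s1]; exact hi2
  · rw [← mon_mul, ← mon_pow, ev_self]; rfl

lemma lift1 {n a s d : ℕ} (h1 : 1 ≤ a) (h2 : a ≤ n) {f : P n} (hf : f ∈ K n s d) :
    XjMon n a 1 * f ^ 2 ∈ K n (s + 1) (d + 1) := by
  let V : Submodule (ZMod 2) (P n) :=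
    { carrier := {f | XjMon n a 1 * f ^ 2 ∈ K n (s + 1) (d + 1)}
      add_mem' := by
        intro x y hx hy
        simp only [Set.mem_ofPred_eq] at *
        rw [CharTwo.add_sq, mul_add]
        exact Submodule.add_mem _ hx hy
      zero_mem' := by simp
      smul_mem' := by
        intro c x hx
        have : c = 0 ∨ c = 1 := by revert c; decide
        rcases this with rfl | rfl
        · simp
        · simpa using hx }
  have hV : K n s d ≤ V := by
    apply sup_le
    · apply AplusS_le
      intro j j1 j2 b
      change XjMon n a 1 * (SqK n j (monomial b 1)) ^ 2 ∈ K n (s + 1) (d + 1)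
      obtain ⟨R, hR, hsq⟩ := sqTot_Xj h1 h2
      set G := sqTot n (monomial b 1) with hG
      have hXd : mdeg (ev fun k : Fin n => if (k : ℕ) + 1 = a then 0 else 1) = n - 1 := by
        simp only [mdeg, ev_app]; exact wt_Xj h1 h2
      have e1 : XjMon n a 1 * (SqK n j (monomial b 1)) ^ 2 =
          homogeneousComponent (n - 1 + 2 * (mdeg b + j)) (XjMon n a 1 * G ^ 2) := by
        rw [SqK_monomial, ← hc_sq, XjMon, hc_mon_mul _ _ _ hXd]
      have e2 : SqK n (2 * j) (XjMon n a 1 * (monomial b 1) ^ 2) =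
          homogeneousComponent (n - 1 + 2 * (mdeg b + j)) ((XjMon n a 1 + R) * G ^ 2) := by
        rw [← hsq, hG, ← map_pow (sqTot n), ← map_mul (sqTot n)]
        have : XjMon n a 1 * (monomial b 1) ^ 2 = monomial
            ((ev fun k : Fin n => if (k : ℕ) + 1 = a then 0 else 1) + 2 • b) 1 := by
          rw [XjMon, monomial_pow, monomial_mul]; simp
        rw [this, SqK_monomial]
        congr 2
        have : mdeg ((ev fun k : Fin n => if (k : ℕ) + 1 = a then 0 else 1) + 2 • b) =
            mdeg (ev fun k : Fin n => if (k : ℕ) + 1 = a then 0 else 1) + 2 * mdeg b := by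
          simp [mdeg, Finset.sum_add_distrib, Finset.mul_sum]
        rw [this, hXd]; ring
      rw [add_mul, map_add, ← e1] at e2
      rw [← sub_eq_iff_eq_add.2 e2]
      apply Submodule.sub_mem
      · apply Submodule.mem_sup_left
        refine Submodule.subset_span ⟨2 * j, by omega, ?_, _, rfl⟩
        rw [pow_succ]; omega
      · apply Submodule.mem_sup_right
        exact Q_hc' (O_le (Nat.succ_pos d) (O_mul_sq hR G)) _
    · unfold Q
      rw [Submodule.span_le]
      rintro _ ⟨b, ⟨i, hi1, hi2⟩, rfl⟩
      change XjMon n a 1 * (monomial b 1) ^ 2 ∈ K n (s + 1) (d + 1)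
      apply Submodule.mem_sup_right
      exact liftQ1 h1 h2 b hi1 hi2
  exact hV hf

lemma sq1 {n : ℕ} (v : Fin n → ℕ) (hv : ∀ k, v k % 2 = 1) :
    SqK n 1 (monomial (ev v) 1) = ∑ j ∈ Finset.Icc 1 n, xvMon n j 1 * monomial (ev v) 1 := by
  have e1 : sqTot n (monomial (ev v) 1) = monomial (ev v) 1 * ∏ k, (1 + X k) ^ v k := by
    rw [sqTot_mon, monE, ← Finset.prod_mul_distrib]
    apply Finset.prod_congr rfl
    intro k _
    rw [← mul_pow]; ring
  rw [SqK_monomial, e1, hc_mon_mul _ _ _ rfl, ← Finset.sum_mul, mul_comm]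
  congr 1
  have e2 : ∑ j ∈ Finset.Icc 1 n, xvMon n j 1 = ∑ k : Fin n, X k := by
    symm
    refine Finset.sum_bij (fun k _ => (k : ℕ) + 1) ?_ ?_ ?_ ?_
    · intro k _; simp
    · intro k _ l _ h; ext; simpa using h
    · intro j hj; simp at hj; exact ⟨⟨j - 1, by omega⟩, by simp, by simp; omega⟩
    · intro k _
      rw [xvMon, X, show Finsupp.single k 1 = ev _ from ?_]
      ext l
      rw [ev_app, Finsupp.single_apply]
      simp only [add_left_inj, Fin.val_inj, eq_comm]
  rw [e2]
  have pd : ∀ (i : Fin n) (s : Finset (Fin n)),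
      constantCoeff (pderiv i (∏ k ∈ s, (1 + X k : P n) ^ v k)) = if i ∈ s then 1 else 0 := by
    classical
    intro i s
    induction s using Finset.induction_on with
    | empty => simp
    | insert k s hk ih =>
      rw [Finset.prod_insert hk, pderiv_mul, map_add, map_mul, map_mul, ih, pderiv_pow]
      have : ((v k : ℕ) : ZMod 2) = 1 := by
        rw [← Nat.mod_add_div (v k) 2, hv k]
        push_cast
        rw [show (2 : ZMod 2) = 0 from rfl]; simp
      by_cases hik : i = k
      · subst hik
        simp [hk, this]
      · simp [hik, Ne.symm hik, pderiv_X]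
  ext m
  rw [coeff_homogeneousComponent]
  split_ifs with h
  · obtain ⟨i, rfl⟩ : ∃ i, m = Finsupp.single i 1 := by
      have h' : m ≠ 0 := by rintro rfl; simp at h
      obtain ⟨i, hi⟩ := Finsupp.ne_iff.1 h'
      refine ⟨i, ?_⟩
      have hle : Finsupp.single i 1 ≤ m := by
        rw [Finsupp.single_le_iff]; simp at hi; omega
      obtain ⟨c, rfl⟩ := exists_add_of_le hle
      rw [map_add, Finsupp.degree_single] at h
      have : c.degree = 0 := by omega
      rw [Finsupp.degree_eq_zero_iff] at this
      rw [this, add_zero]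
    have := pd i Finset.univ
    rw [constantCoeff_eq, coeff_pderiv] at this
    simp at this
    rw [this, coeff_sum]
    simp [coeff_X, Finsupp.single_left_inj]
  · rw [coeff_sum]
    symm
    apply Finset.sum_eq_zero
    intro k _
    rw [coeff_X, if_neg]
    rintro rfl
    simp at h

end St
namespace St

def E (n : ℕ) : List ℕ → P n → P n
  | [], g => g
  | a :: v, g => XjMon n a 1 * (E n v g) ^ 2

lemma E_add {n : ℕ} (v : List ℕ) (f g : P n) : E n v (f + g) = E n v f + E n v g := by
  induction v with
  | nil => rfl
  | cons a v ih => simp only [E, ih, CharTwo.add_sq, mul_add]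

lemma E_zero {n : ℕ} (v : List ℕ) : E n v (0 : P n) = 0 := by
  induction v with
  | nil => rfl
  | cons a v ih => simp [E, ih]

lemma E_sum {n : ℕ} {ι : Type*} (v : List ℕ) (s : Finset ι) (f : ι → P n) :
    E n v (∑ i ∈ s, f i) = ∑ i ∈ s, E n v (f i) := by
  classical
  induction s using Finset.induction_on with
  | empty => simp [E_zero]
  | insert a s h ih => rw [Finset.sum_insert h, Finset.sum_insert h, E_add, ih]

lemma E_append {n : ℕ} (v w : List ℕ) (g : P n) : E n (v ++ w) g = E n v (E n w g) := by
  induction v with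
  | nil => rfl
  | cons a v ih => simp [E, ih]

def Ok (n : ℕ) (v : List ℕ) : Prop := ∀ a ∈ v, 1 ≤ a ∧ a ≤ n

lemma lift {n s d : ℕ} {v : List ℕ} (hv : Ok n v) {f : P n} (hf : f ∈ K n s d) :
    E n v f ∈ K n (s + v.length) (d + v.length) := by
  induction v with
  | nil => exact hf
  | cons a v ih =>
    have := hv a (by simp)
    exact lift1 this.1 this.2 (ih fun b hb => hv b (by simp [hb]))

lemma liftQ {n d : ℕ} {v : List ℕ} (hv : Ok n v) {f : P n} (hf : f ∈ Q n (wSpike n d)) :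
    E n v f ∈ Q n (wSpike n (d + v.length)) := by
  induction v with
  | nil => exact hf
  | cons a v ih =>
    have := hv a (by simp)
    have h := ih fun b hb => hv b (by simp [hb])
    rw [E]
    clear ih
    generalize E n v f = g at *
    rw [List.length_cons, ← add_assoc]
    generalize d + v.length = d' at *
    unfold Q at h
    induction h using Submodule.span_induction with
    | mem x hx =>
      obtain ⟨b, ⟨i, hi1, hi2⟩, rfl⟩ := hx
      exact liftQ1 this.1 this.2 b hi1 hi2
    | zero => simp
    | add x y _ _ hx hy =>
      rw [CharTwo.add_sq, mul_add]; exact Submodule.add_mem _ hx hy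
    | smul c x _ hx =>
      rw [smul_pow, mul_smul_comm]; exact Submodule.smul_mem _ _ hx

/-- full product -/
def al (n : ℕ) : P n := monomial (ev fun _ => 1) 1

lemma Xj_mul_xv (n j : ℕ) : XjMon n j 1 * xvMon n j 1 = al n := by
  rw [XjMon, xvMon, mon_mul, al]
  congr 3
  funext k
  split_ifs <;> rfl

lemma E_rep (n j c : ℕ) (m : P n) :
    E n (List.replicate c j) (xvMon n j 1 * m) = xvMon n j 1 * (al n ^ (2 ^ c - 1) * m ^ 2 ^ c) := by
  induction c with
  | zero => simp [E]
  | succ c ih =>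
    rw [List.replicate_succ, E, ih]
    have h : 2 ^ (c + 1) - 1 = 1 + 2 * (2 ^ c - 1) := by
      have := Nat.one_le_two_pow (n := c); rw [pow_succ]; omega
    rw [h, ← Xj_mul_xv n j]; ring

def IsMon {n : ℕ} (p : P n) : Prop := ∃ v : Fin n → ℕ, p = monomial (ev v) 1

lemma IsMon.mul {n : ℕ} {p q : P n} (hp : IsMon p) (hq : IsMon q) : IsMon (p * q) := by
  obtain ⟨v, rfl⟩ := hp
  obtain ⟨w, rfl⟩ := hq
  exact ⟨_, mon_mul v w⟩

lemma IsMon.pow {n : ℕ} {p : P n} (hp : IsMon p) (e : ℕ) : IsMon (p ^ e) := by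
  obtain ⟨v, rfl⟩ := hp
  exact ⟨_, mon_pow v e⟩

lemma IsMon_xv (n u e : ℕ) : IsMon (xvMon n u e) := ⟨_, rfl⟩

lemma IsMon_E {n : ℕ} (v : List ℕ) {g : P n} (hg : IsMon g) : IsMon (E n v g) := by
  induction v with
  | nil => exact hg
  | cons a v ih => exact IsMon.mul ⟨_, rfl⟩ (ih.pow 2)

lemma rel {n c : ℕ} (hc : 1 ≤ c) {m : P n} (hm : IsMon m) :
    ∑ j ∈ Finset.Icc 1 n, E n (List.replicate c j) (xvMon n j 1 * m) ∈ AplusS n 1 := by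
  simp only [E_rep]
  obtain ⟨v, rfl⟩ := hm
  rw [al, mon_pow, mon_pow, mon_mul, ← sq1]
  · exact Submodule.subset_span ⟨1, le_refl _, by norm_num, _, rfl⟩
  · intro k
    obtain ⟨c, rfl⟩ := Nat.exists_eq_add_of_le' hc
    have := Nat.one_le_two_pow (n := c)
    rw [pow_succ, mul_comm (2 ^ c) 2, mul_assoc]
    generalize 2 ^ c * v k = y
    omega

/-- middle monomial -/
def Xab (n a b : ℕ) : P n :=
  monomial (ev fun k : Fin n => if (k : ℕ) + 1 = a ∨ (k : ℕ) + 1 = b then 0 else 1) 1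

lemma xv_Xab {n a b : ℕ} (hab : a ≠ b) : xvMon n a 1 * Xab n a b = XjMon n b 1 := by
  rw [xvMon, Xab, mon_mul, XjMon]
  congr 3
  funext k
  split_ifs <;> omega

lemma Xab_comm (n a b : ℕ) : Xab n a b = Xab n b a := by
  simp only [Xab, or_comm]

lemma xv_Xab_O {n a b j : ℕ} (ha : 1 ≤ a ∧ a ≤ n) (hb : 1 ≤ b ∧ b ≤ n) (hab : a ≠ b)
    (hja : j ≠ a) (hjb : j ≠ b) : xvMon n j 1 * Xab n a b ∈ O n (n - 1) := by
  rw [xvMon, Xab, mon_mul]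
  refine Submodule.subset_span ⟨_, ?_, rfl⟩
  have h : ∑ k : Fin n, (((if (k : ℕ) + 1 = a ∨ (k : ℕ) + 1 = b then 0 else 1) +
      (if (k : ℕ) + 1 = a then 1 else 0)) + (if (k : ℕ) + 1 = b then 1 else 0)) = n := by
    rw [Finset.sum_congr rfl (g := fun _ => 1)]
    · simp
    · intro k _; split_ifs <;> omega
  rw [Finset.sum_add_distrib, Finset.sum_add_distrib, sum_ind ha.1 ha.2, sum_ind hb.1 hb.2] at h
  refine lt_of_le_of_lt (b := ∑ k : Fin n, (if (k : ℕ) + 1 = a ∨ (k : ℕ) + 1 = b then 0 else 1))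
    ?_ (by omega)
  simp only [wt, ev_app]
  apply Finset.sum_le_sum
  intro k _
  simp only [pow_zero, Nat.div_one]
  split_ifs <;> omega

/-- equivalence of words -/
def Eqv (n u s : ℕ) (v w : List ℕ) : Prop :=
  v.length = w.length ∧ E n v (xvMon n u 1) + E n w (xvMon n u 1) ∈ K n s v.length

lemma Eqv.refl (n u s : ℕ) (v : List ℕ) : Eqv n u s v v :=
  ⟨rfl, by rw [two_zero]; exact zero_mem _⟩

lemma Eqv.symm {n u s : ℕ} {v w : List ℕ} (h : Eqv n u s v w) : Eqv n u s w v :=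
  ⟨h.1.symm, by rw [add_comm, ← h.1]; exact h.2⟩

lemma Eqv.trans {n u s : ℕ} {v w x : List ℕ} (h : Eqv n u s v w) (h' : Eqv n u s w x) :
    Eqv n u s v x := by
  refine ⟨h.1.trans h'.1, ?_⟩
  have := Submodule.add_mem _ h.2 (h.1 ▸ h'.2)
  convert this using 1
  have e := two_zero (E n w (xvMon n u 1))
  linear_combination -e

lemma Eqv.mono {n u s s' : ℕ} (hs : s ≤ s') {v w : List ℕ} (h : Eqv n u s v w) :
    Eqv n u s' v w := ⟨h.1, K_mono hs h.2⟩

lemma Eqv.lift {n u s : ℕ} {x v w : List ℕ} (hx : Ok n x) (h : Eqv n u s v w) :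
    Eqv n u (s + x.length) (x ++ v) (x ++ w) := by
  refine ⟨by simp [h.1], ?_⟩
  rw [E_append, E_append, ← E_add, List.length_append, add_comm x.length v.length]
  exact St.lift hx h.2

lemma F1 {n u a b c : ℕ} (hc : 1 ≤ c) (ha : 1 ≤ a ∧ a ≤ n) (hb : 1 ≤ b ∧ b ≤ n) (z : List ℕ) :
    Eqv n u 1 (List.replicate c a ++ b :: z) (List.replicate c b ++ a :: z) := by
  by_cases hab : a = b
  · subst hab; exact Eqv.refl _ _ _ _
  refine ⟨by simp, ?_⟩
  set g := E n z (xvMon n u 1) with hg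
  have hm : IsMon (Xab n a b * g ^ 2) := IsMon.mul ⟨_, rfl⟩ ((IsMon_E z (IsMon_xv n u 1)).pow 2)
  have h := rel hc hm
  have ma : a ∈ Finset.Icc 1 n := by simp [ha]
  have mb : b ∈ (Finset.Icc 1 n).erase a := by simp [hb, Ne.symm hab]
  rw [← Finset.add_sum_erase _ _ ma, ← Finset.add_sum_erase _ _ mb, ← add_assoc] at h
  rw [← mul_assoc, xv_Xab hab] at h
  rw [← mul_assoc (xvMon n b 1), Xab_comm n a b, xv_Xab (Ne.symm hab)] at h
  rw [E_append, E_append, E, E]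
  rw [← add_sub_cancel_right (_ + _) (∑ x ∈ ((Finset.Icc 1 n).erase a).erase b, _)]
  refine Submodule.sub_mem _ (Submodule.mem_sup_left h) ?_
  apply Submodule.sum_mem
  intro j hj
  simp only [Finset.mem_erase, Finset.mem_Icc] at hj
  rw [← mul_assoc, List.length_append, add_comm]
  have ok : Ok n (List.replicate c j) := by
    intro x hx; rw [List.eq_of_mem_replicate hx]; exact hj.2.2
  have hq : xvMon n j 1 * Xab n b a * g ^ 2 ∈ Q n (wSpike n (b :: z).length) :=
    O_le (by simp) (O_mul_sq (xv_Xab_O hb ha (Ne.symm hab) hj.1 hj.2.1) g)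
  have := liftQ ok hq
  rw [List.length_replicate] at this ⊢
  exact Submodule.mem_sup_right this

lemma Eqv.swap {n u a b : ℕ} (ha : 1 ≤ a ∧ a ≤ n) (hb : 1 ≤ b ∧ b ≤ n) (z : List ℕ) :
    Eqv n u 1 (a :: b :: z) (b :: a :: z) := F1 (c := 1) le_rfl ha hb z

lemma Eqv.perm {n u : ℕ} {v w : List ℕ} (h : v.Perm w) (hv : Ok n v) (z : List ℕ) :
    Eqv n u v.length (v ++ z) (w ++ z) := by
  induction h with
  | nil => exact Eqv.refl _ _ _ _
  | cons x h ih =>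
    have := Eqv.lift (x := [x]) (by intro b hb; simp at hb; subst hb; exact hv b (by simp))
      (ih fun b hb => hv b (by simp [hb]))
    simpa using this
  | swap x y l =>
    exact (Eqv.swap (hv y (by simp)) (hv x (by simp)) (l ++ z)).mono (by simp)
  | trans h1 h2 ih1 ih2 =>
    refine (ih1 hv).trans ?_
    rw [h1.length_eq]
    exact ih2 fun b hb => hv b (h1.mem_iff.2 hb)

lemma move {n u : ℕ} (k : ℕ) (hk : 1 ≤ k) : ∀ {a b : ℕ} (_ : 1 ≤ a ∧ a ≤ n) (_ : 1 ≤ b ∧ b ≤ n)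
    (z : List ℕ), Eqv n u 2 (a :: (List.replicate k b ++ z)) (List.replicate k b ++ a :: z) := by
  induction k, hk using Nat.le_induction with
  | base =>
    intro a b ha hb z
    exact (Eqv.swap ha hb z).mono (by norm_num)
  | succ k hk ih =>
    intro a b ha hb z
    have e : ∀ x y : List ℕ, List.replicate (k + 1) b ++ x = List.replicate k b ++ b :: x := by
      intro x _; rw [List.replicate_succ']; simp
    rw [e z z]
    have s1 := ih ha hb (b :: z)
    have s2 := (F1 (u := u) hk hb ha (b :: z)).mono (s' := 2) (by norm_num)
    have s3 := (ih hb ha (b :: z)).symm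
    have s4 : Eqv n u 2 (b :: (List.replicate k a ++ b :: z)) (b :: (List.replicate k b ++ a :: z)) :=
      Eqv.lift (x := [b]) (by intro c hc; simp at hc; subst hc; exact hb) (F1 (u := u) hk ha hb z)
    have := ((s1.trans s2).trans s3).trans s4
    rw [List.replicate_succ]
    exact this

lemma flip {n u k a b : ℕ} (hk : 1 ≤ k) (ha : 1 ≤ a ∧ a ≤ n) (hb : 1 ≤ b ∧ b ≤ n) :
    Eqv n u 2 (a :: List.replicate k b) (b :: List.replicate k a) := by
  have s1 := move (u := u) k hk ha hb []
  have s2 := (F1 (u := u) hk hb ha []).mono (s' := 2) (by norm_num)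
  have s3 := (move (u := u) k hk hb ha []).symm
  simpa using (s1.trans s2).trans s3

end St
namespace St

def mm (x : ℕ) : List ℕ → ℕ
  | [] => 0
  | a :: v => (if x = a then 1 else 0) + 2 * mm x v

def ex (x : ℕ) : List ℕ → ℕ
  | [] => 0
  | a :: v => (if x = a then 0 else 1) + 2 * ex x v

lemma ex_mm (x : ℕ) (v : List ℕ) : ex x v + mm x v + 1 = 2 ^ v.length := by
  induction v with
  | nil => rfl
  | cons a v ih =>
    simp only [ex, mm, List.length_cons, pow_succ]
    split_ifs <;> omega

lemma mm_append (x : ℕ) (v w : List ℕ) : mm x (v ++ w) = mm x v + 2 ^ v.length * mm x w := by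
  induction v with
  | nil => simp [mm]
  | cons a v ih => simp only [List.cons_append, mm, ih, List.length_cons]; ring

lemma mm_notin {x : ℕ} {v : List ℕ} (h : x ∉ v) : mm x v = 0 := by
  induction v with
  | nil => rfl
  | cons a v ih =>
    simp only [List.mem_cons, not_or] at h
    simp [mm, h.1, ih h.2]

lemma mm_rep (x c : ℕ) : mm x (List.replicate c x) + 1 = 2 ^ c := by
  induction c with
  | zero => rfl
  | succ c ih => simp only [List.replicate_succ, mm, if_true, pow_succ]; omega

lemma mm_rev (x : ℕ) (l : List ℕ) : mm x l.reverse =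
    ∑ t ∈ Finset.range l.length, if l.getD t 0 = x then 2 ^ (l.length - 1 - t) else 0 := by
  induction l with
  | nil => rfl
  | cons a l ih =>
    rw [List.reverse_cons, mm_append, ih, List.length_cons, Finset.sum_range_succ']
    congr 1
    · apply Finset.sum_congr rfl
      intro t _
      simp only [List.getD_cons_succ]
      congr 2
      omega
    · simp [mm, eq_comm]

lemma xIu_one (n : ℕ) (l : List ℕ) (k : Fin n) : xIuExp n l 1 k = mm ((k : ℕ) + 1) l.reverse := by
  rw [mm_rev]
  cases l with
  | nil => simp [xIuExp]
  | cons a l =>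
    rw [List.length_cons, Finset.sum_range_succ', add_comm, xIuExp]
    congr 1
    · simp only [List.length_cons, Nat.sub_self, List.getD_cons_zero, Nat.add_sub_cancel, Nat.sub_zero]
      split_ifs
      · rw [pow_succ]; omega
      · rfl
    · simp only [List.length_cons]
      refine Finset.sum_bij' (fun t _ => t - 2) (fun t _ => t + 2) ?_ ?_ ?_ ?_ ?_
      · intro t ht; simp at ht ⊢; omega
      · intro t ht; simp at ht ⊢; omega
      · intro t ht; simp at ht ⊢; omega
      · intro t ht; simp
      · intro t ht
        simp at ht
        rw [show t - 2 + 1 = t - 1 by omega, show l.length + 1 - 1 - (t - 1) = l.length + 1 - t by omega]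

lemma E_exp (n u : ℕ) (v : List ℕ) : E n v (xvMon n u 1) =
    monomial (ev fun k : Fin n => ex ((k : ℕ) + 1) v +
      (if (k : ℕ) + 1 = u then 2 ^ v.length else 0)) 1 := by
  induction v with
  | nil => simp [E, xvMon, ex]
  | cons a v ih =>
    rw [E, ih, XjMon, mon_pow, mon_mul]
    congr 3
    funext k
    simp only [ex, List.length_cons, pow_succ]
    split_ifs <;> omega

lemma mapD {n i e : ℕ} (hi : 1 ≤ i ∧ i ≤ n) (k : Fin n) :
    Finsupp.mapDomain (fIdx n i) (Xexp (n - 1) e) k = if (k : ℕ) + 1 = i then 0 else e := by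
  have inj : Function.Injective (fIdx n i) := by
    intro a b h
    unfold fIdx at h
    ext
    split_ifs at h <;> simp at h <;> omega
  split_ifs with h
  · apply Finsupp.mapDomain_notin_range
    rintro ⟨j, hj⟩
    unfold fIdx at hj
    have := congrArg Fin.val hj
    split_ifs at this <;> simp at this <;> omega
  · have hk := k.isLt
    obtain ⟨j, rfl⟩ : ∃ j, fIdx n i j = k := by
      by_cases hlt : (k : ℕ) + 1 < i
      · refine ⟨⟨k, by omega⟩, ?_⟩
        ext; simp [fIdx, hlt]
      · refine ⟨⟨k - 1, by omega⟩, ?_⟩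
        ext; simp only [fIdx]
        rw [if_neg (by simp; omega)]; simp; omega
    rw [Finsupp.mapDomain_apply inj]; rfl

lemma phi_eq {n i d u : ℕ} (hn : 2 ≤ n) (hi : 1 ≤ i ∧ i ≤ n) {l : List ℕ} (hl : Ok n l)
    (hil : i ∉ l) (hd : l.length < d) :
    phiMon n i l (Xexp (n - 1) (2 ^ d - 1)) * xvMon n u (2 ^ d) =
      E n (l.reverse ++ List.replicate (d - l.length) i) (xvMon n u 1) := by
  have hpow : 2 ^ l.length < 2 ^ d := Nat.pow_lt_pow_right (by norm_num) hd
  have hpos := Nat.one_le_two_pow (n := l.length)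
  have hnu : ∀ x ∈ l, nuE (Xexp (n - 1) (2 ^ d - 1)) (x - 1) = 2 ^ d - 1 := by
    intro x hx
    have := hl x hx
    rw [nuE, dif_pos (by omega)]; rfl
  have hmem : ∀ t, t < l.length → l.getD t 0 ∈ l := by
    intro t ht; rw [List.getD_eq_getElem _ _ ht]; exact List.getElem_mem ht
  have hex : ∃ u, uCompat l u (Xexp (n - 1) (2 ^ d - 1)) := by
    refine ⟨1, ?_⟩
    unfold uCompat
    split_ifs with h
    · rfl
    · have hlen : 0 < l.length := List.length_pos_iff.2 h
      refine ⟨le_rfl, hlen, by intro t; omega, ?_, ?_, ?_⟩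
      · rw [hnu _ (hmem _ (by omega))]; omega
      · intro t h1 h2
        rw [hnu _ (hmem _ (by omega)), Nat.testBit_two_pow_sub_one]
        simp; omega
      · intro t h1 h2
        rw [hnu _ (hmem _ (by omega)), Nat.testBit_two_pow_sub_one]
        simp; omega
  have huniq : ∀ u, uCompat l u (Xexp (n - 1) (2 ^ d - 1)) → u = 1 := by
    intro u hu
    unfold uCompat at hu
    split_ifs at hu with h
    · exact hu
    · by_contra hne
      have h3 := hu.2.2.1 1 le_rfl (by omega)
      rw [hnu _ (hmem _ (by omega))] at h3
      omega
  rw [phiMon, dif_pos hex, huniq _ (Classical.choose_spec hex), xvMon, mon_mul, E_exp]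
  congr 3
  funext k
  have hlen : (l.reverse ++ List.replicate (d - l.length) i).length = d := by simp; omega
  rw [hlen]
  congr 1
  have h1 := ex_mm ((k : ℕ) + 1) (l.reverse ++ List.replicate (d - l.length) i)
  rw [hlen, mm_append] at h1
  rw [mapD hi, xIu_one]
  simp only [List.length_reverse] at h1
  split_ifs with hk
  · rw [hk] at h1 ⊢
    rw [mm_notin (x := i) (v := l.reverse) (by simpa using hil)] at h1 ⊢
    have h2 := mm_rep i (d - l.length)
    have h3 : 2 ^ d = 2 ^ l.length * 2 ^ (d - l.length) := by
      rw [← pow_add]; congr 1; omega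
    rw [h3, ← h2, mul_add] at h1
    omega
  · rw [mm_notin (v := List.replicate _ i) (by simp [List.mem_replicate, hk])] at h1
    omega

lemma E_hom {n u : ℕ} (hu : 1 ≤ u ∧ u ≤ n) {v : List ℕ} (hv : Ok n v) :
    (E n v (xvMon n u 1)).IsHomogeneous ((n - 1) * (2 ^ v.length - 1) + 2 ^ v.length) := by
  induction v with
  | nil =>
    apply isHomogeneous_monomial
    rw [degree_eq]
    simp [mdeg, ev_app, sum_ind hu.1 hu.2]
  | cons a v ih =>
    have ha := hv a (by simp)
    have h1 : (XjMon n a 1).IsHomogeneous (n - 1) := by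
      apply isHomogeneous_monomial
      rw [degree_eq]
      simp only [mdeg, ev_app, wt_Xj ha.1 ha.2]
    have := h1.mul ((ih fun b hb => hv b (by simp [hb])).pow 2)
    rw [E]
    convert this using 1
    have h := Nat.one_le_two_pow (n := v.length)
    obtain ⟨m, hm⟩ := Nat.exists_eq_add_of_le h
    rw [List.length_cons, pow_succ, hm, show (1 + m) * 2 - 1 = 1 + 2 * m by omega,
      show 1 + m - 1 = m by omega]
    ring

/-- word of a finite set, largest first, followed by a constant tail -/
def wd (d : ℕ) (J : Finset ℕ) (j : ℕ) : List ℕ :=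
  (J.sort (· ≤ ·)).reverse ++ List.replicate (d - J.card) j

lemma perm_of {l : List ℕ} {J : Finset ℕ} (hl : l.Nodup) (h : ∀ x, x ∈ J ↔ x ∈ l) :
    ((J.sort (· ≤ ·)).reverse).Perm l := by
  rw [List.perm_ext_iff_of_nodup (List.nodup_reverse.2 (Finset.sort_nodup J _)) hl]
  intro x
  simp [h]

lemma len_wd {d j : ℕ} {J : Finset ℕ} (h : J.card ≤ d) : (wd d J j).length = d := by
  simp [wd]; omega

lemma per_u {n d t u : ℕ} {T : Finset ℕ} (hT : ∀ x ∈ T, 1 ≤ x ∧ x ≤ n) (ht : t ∈ T) (hu : u ∈ T)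
    (hd : T.card ≤ d) :
    E n (wd d (T.erase t) t) (xvMon n u 1) +
      ∑ J ∈ T.ssubsets, E n (wd d J u) (xvMon n u 1) ∈ K n T.card d := by
  classical
  set F : Finset ℕ → P n := fun J => E n (wd d J u) (xvMon n u 1) with hF
  have hpos : 0 < T.card := Finset.card_pos.2 ⟨t, ht⟩
  have cu := Finset.card_erase_of_mem hu
  have ct := Finset.card_erase_of_mem ht
  have split : ∑ J ∈ T.ssubsets, F J =
      ∑ J ∈ (T.erase u).ssubsets, (F J + F (insert u J)) + F (T.erase u) := by
    have e1 : ∑ J ∈ T.ssubsets, F J + F T = ∑ J ∈ T.powerset, F J :=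
      Finset.sum_erase_add _ _ (Finset.mem_powerset_self T)
    have e2 : ∑ J ∈ (T.erase u).ssubsets, (F J + F (insert u J)) + (F (T.erase u) + F T) =
        ∑ J ∈ (T.erase u).powerset, (F J + F (insert u J)) := by
      have := Finset.sum_erase_add (T.erase u).powerset (fun J => F J + F (insert u J))
        (Finset.mem_powerset_self (T.erase u))
      simp only [Finset.insert_erase hu] at this
      exact this
    have e3 : ∑ J ∈ T.powerset, F J = ∑ J ∈ (T.erase u).powerset, (F J + F (insert u J)) := by
      conv_lhs => rw [← Finset.insert_erase hu]
      rw [Finset.sum_powerset_insert (Finset.notMem_erase u T), Finset.sum_add_distrib]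
    rw [← e3, ← e1] at e2
    linear_combination -e2
  rw [split, add_left_comm]
  refine Submodule.add_mem _ (Submodule.sum_mem _ ?_) ?_
  · intro J hJ
    rw [Finset.mem_ssubsets] at hJ
    have hc := Finset.card_lt_card hJ
    have huJ : u ∉ J := fun h => Finset.notMem_erase u T (hJ.1 h)
    have hJT : ∀ x ∈ J, 1 ≤ x ∧ x ≤ n := fun x hx => hT x (Finset.mem_of_mem_erase (hJ.1 hx))
    have ci := Finset.card_insert_of_notMem huJ
    have hp : ((insert u J).sort (· ≤ ·)).reverse.Perm ((J.sort (· ≤ ·)).reverse ++ [u]) := by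
      apply perm_of
      · rw [List.nodup_append]
        refine ⟨List.nodup_reverse.2 (Finset.sort_nodup J _), by simp, ?_⟩
        intro a ha b hb
        simp at ha hb
        rintro rfl
        subst hb; exact huJ ha
      · intro x; simp [or_comm]
    have ok : Ok n ((insert u J).sort (· ≤ ·)).reverse := by
      intro x hx
      simp at hx
      rcases hx with rfl | hx
      · exact hT _ hu
      · exact hJT x hx
    have h := (Eqv.perm (u := u) hp ok (List.replicate (d - (insert u J).card) u)).symm
    have e : ((J.sort (· ≤ ·)).reverse ++ [u]) ++ List.replicate (d - (insert u J).card) u =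
        wd d J u := by
      rw [wd, ci, show d - J.card = d - (J.card + 1) + 1 by omega, List.replicate_succ]
      simp
    rw [e] at h
    have h2 := (h.mono (s' := T.card) (by simp [ci]; omega)).2
    rw [len_wd (by omega)] at h2
    exact h2
  · by_cases hut : u = t
    · subst hut
      rw [two_zero]; exact zero_mem _
    · set W := ((T.erase t).erase u).toList with hW
      have hWm : ∀ x, x ∈ W ↔ x ≠ u ∧ x ≠ t ∧ x ∈ T := by
        intro x; simp [hW]
      have hWl : W.length + 2 = T.card := by
        rw [hW, Finset.length_toList, Finset.card_erase_of_mem (by simp [hut, hu]), ct]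
        have : 0 < (T.erase t).card := Finset.card_pos.2 ⟨u, by simp [hut, hu]⟩
        omega
      have hWn : W.Nodup := Finset.nodup_toList _
      have okW : Ok n W := fun x hx => hT x ((hWm x).1 hx).2.2
      have nd : ∀ y, y ∉ W → (W ++ [y]).Nodup := by
        intro y hy
        rw [List.nodup_append]
        refine ⟨hWn, by simp, ?_⟩
        intro a ha b hb
        simp at hb
        rintro rfl
        subst hb; exact hy ha
      have p1 : ((T.erase t).sort (· ≤ ·)).reverse.Perm (W ++ [u]) := by
        apply perm_of (nd u (by simp [hWm]))
        intro x
        simp only [Finset.mem_erase, List.mem_append, hWm, List.mem_singleton]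
        by_cases hx : x = u
        · subst hx; simp [hut, hu]
        · simp [hx]
      have p2 : ((T.erase u).sort (· ≤ ·)).reverse.Perm (W ++ [t]) := by
        apply perm_of (nd t (by simp [hWm]))
        intro x
        simp only [Finset.mem_erase, List.mem_append, hWm, List.mem_singleton]
        by_cases hx : x = t
        · subst hx; simp [Ne.symm hut, ht]
        · simp [hx]
      have ok : ∀ y, Ok n ((T.erase y).sort (· ≤ ·)).reverse := by
        intro y x hx
        simp at hx
        exact hT x hx.2
      have s1 := Eqv.perm (u := u) p1 (ok t) (List.replicate (d - (T.erase t).card) t)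
      have s2 := Eqv.perm (u := u) p2 (ok u) (List.replicate (d - (T.erase u).card) u)
      rw [List.append_assoc] at s1 s2
      have s3 := Eqv.lift okW (flip (u := u) (k := d - (T.erase t).card) (by omega) (hT u hu) (hT t ht))
      have hs : 2 + W.length = T.card := by omega
      rw [hs] at s3
      rw [cu, ← ct] at s2
      have := ((s1.mono (s' := T.card) (by simp; omega)).trans s3).trans
        (s2.mono (s' := T.card) (by simp; omega)).symm
      have h2 := this.2
      rw [show (((T.erase t).sort (· ≤ ·)).reverse ++ List.replicate (d - (T.erase t).card) t).length
        = d from len_wd (j := t) (by omega)] at h2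
      rw [hF]
      simp only [wd]
      rw [show d - (T.erase u).card = d - (T.erase t).card by omega]
      exact h2

lemma relJ {n d : ℕ} {J : Finset ℕ} (hJ : ∀ x ∈ J, 1 ≤ x ∧ x ≤ n) (hd : J.card < d) :
    ∑ j ∈ Finset.Icc 1 n, E n (wd d J j) (xvMon n j 1) ∈ K n (J.card + 1) d := by
  have h1 := rel (n := n) (c := d - J.card) (by omega) (m := 1) ⟨fun _ => 0, by
    rw [monE]; simp⟩
  have h2 : _ ∈ K n 1 (d - J.card) := Submodule.mem_sup_left h1
  have h3 := lift (v := (J.sort (· ≤ ·)).reverse) (by intro x hx; simp at hx; exact hJ x hx) h2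
  rw [E_sum] at h3
  simp only [wd, E_append]
  simp only [mul_one, List.length_reverse, Finset.length_sort] at h3
  rw [add_comm J.card 1]
  rw [show d - J.card + J.card = d by omega] at h3
  exact h3

end St
/-- Proposition 3.12: for `1 < t ≤ n` and `d > n − t + 1`, with
`Y_t = Σ_{u=t}^{n} φ_{(t;I_t)}(X^{2^d−1}) x_u^{2^d}`, there is a finite set of pairs
`(j;J) ∈ N_n` with `1 ≤ j < t`, `J ⊆ I_{t−1} = (t, …, n)` and `J ≠ I_{t−1}`, such that
`Y_t + Σ φ_{(j;J)}(X^{2^d−1}) x_j^{2^d} ∈ A_{n−t+1}^+P_n + P_n^−(ω)`,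
`ω = ((n−1)^{(d)}, 1)`. -/
theorem statement13 (n t d : ℕ) (ht1 : 1 < t) (ht2 : t ≤ n) (hd : n - t + 1 < d) :
    ∃ S : Finset (ℕ × Finset ℕ),
      (∀ p ∈ S, 1 ≤ p.1 ∧ p.1 < t ∧ p.2 ⊆ Finset.Icc t n ∧ p.2 ≠ Finset.Icc t n) ∧
      (∑ u ∈ Finset.Icc t n,
          phiMon n t ((Finset.Icc (t + 1) n).sort (· ≤ ·)) (Xexp (n - 1) (2 ^ d - 1))
            * xvMon n u (2 ^ d))
        + (∑ p ∈ S,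
            phiMon n p.1 (p.2.sort (· ≤ ·)) (Xexp (n - 1) (2 ^ d - 1))
              * xvMon n p.1 (2 ^ d))
        ∈ AplusS n (n - t + 1) ⊔ PnLt n ((n - 1) * (2 ^ d - 1) + 2 ^ d) (wSpike n d) := by
  classical
  have hn : 2 ≤ n := by omega
  set T := Finset.Icc t n with hT
  have hcard : T.card = n - t + 1 := by rw [hT, Nat.card_Icc]; omega
  have hTn : ∀ x ∈ T, 1 ≤ x ∧ x ≤ n := by
    intro x hx; rw [hT, Finset.mem_Icc] at hx; omega
  have htT : t ∈ T := by rw [hT, Finset.mem_Icc]; omega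
  have her : Finset.Icc (t + 1) n = T.erase t := by
    ext x; rw [hT, Finset.mem_erase, Finset.mem_Icc, Finset.mem_Icc]; omega
  have hec : (T.erase t).card = n - t := by rw [Finset.card_erase_of_mem htT]; omega
  have okwd : ∀ (J : Finset ℕ) (j : ℕ), J ⊆ T → 1 ≤ j → j ≤ n → St.Ok n (St.wd d J j) := by
    intro J j hJ h1 h2 a ha
    simp only [St.wd, List.mem_append, List.mem_reverse, Finset.mem_sort, List.mem_replicate] at ha
    rcases ha with ha | ha
    · exact hTn a (hJ ha)
    · rw [ha.2]; exact ⟨h1, h2⟩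
  have hphi : ∀ (J : Finset ℕ) (j u : ℕ), J ⊆ T → 1 ≤ j → j ≤ n → j ∉ J → J.card < d →
      phiMon n j (J.sort (· ≤ ·)) (Xexp (n - 1) (2 ^ d - 1)) * xvMon n u (2 ^ d)
        = St.E n (St.wd d J j) (xvMon n u 1) := by
    intro J j u hJ h1 h2 h3 h4
    have := St.phi_eq (n := n) (i := j) (u := u) (d := d) (l := J.sort (· ≤ ·)) hn ⟨h1, h2⟩
      (fun a ha => hTn a (hJ ((Finset.mem_sort _).1 ha)))
      (fun h => h3 ((Finset.mem_sort _).1 h)) (by rw [Finset.length_sort]; exact h4)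
    rw [this, Finset.length_sort]
    rfl
  have hhom : ∀ (J : Finset ℕ) (j u : ℕ), J ⊆ T → 1 ≤ j → j ≤ n → 1 ≤ u → u ≤ n → J.card ≤ d →
      (St.E n (St.wd d J j) (xvMon n u 1)).IsHomogeneous ((n - 1) * (2 ^ d - 1) + 2 ^ d) := by
    intro J j u hJ h1 h2 h3 h4 h5
    have := St.E_hom (n := n) (u := u) (v := St.wd d J j) ⟨h3, h4⟩ (okwd J j hJ h1 h2)
    rwa [St.len_wd h5] at this
  have hss : ∀ J ∈ T.ssubsets, J ⊆ T ∧ J.card < n - t + 1 := by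
    intro J hJ
    rw [Finset.mem_ssubsets] at hJ
    exact ⟨hJ.1, hcard ▸ Finset.card_lt_card hJ⟩
  refine ⟨Finset.Icc 1 (t - 1) ×ˢ T.ssubsets, ?_, ?_⟩
  · intro p hp
    rw [Finset.mem_product, Finset.mem_Icc, Finset.mem_ssubsets] at hp
    exact ⟨hp.1.1, by omega, hp.2.1, hp.2.ne⟩
  rw [Finset.sum_product]
  have e1 : (∑ u ∈ T, phiMon n t ((Finset.Icc (t + 1) n).sort (· ≤ ·)) (Xexp (n - 1) (2 ^ d - 1))
            * xvMon n u (2 ^ d)) = ∑ u ∈ T, St.E n (St.wd d (T.erase t) t) (xvMon n u 1) := by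
    rw [her]
    refine Finset.sum_congr rfl fun u _ => ?_
    exact hphi _ _ _ (Finset.erase_subset _ _) (by omega) ht2 (Finset.notMem_erase _ _) (by omega)
  have e2 : (∑ j ∈ Finset.Icc 1 (t - 1), ∑ J ∈ T.ssubsets,
      phiMon n j (J.sort (· ≤ ·)) (Xexp (n - 1) (2 ^ d - 1)) * xvMon n j (2 ^ d))
      = ∑ j ∈ Finset.Icc 1 (t - 1), ∑ J ∈ T.ssubsets, St.E n (St.wd d J j) (xvMon n j 1) := by
    refine Finset.sum_congr rfl fun j hj => Finset.sum_congr rfl fun J hJ => ?_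
    rw [Finset.mem_Icc] at hj
    have h := hss J hJ
    refine hphi _ _ _ h.1 hj.1 (by omega) (fun hjJ => ?_) (by omega)
    have := h.1 hjJ
    rw [hT, Finset.mem_Icc] at this
    omega
  rw [e1, e2]
  apply St.final
  · have m1 : (∑ J ∈ T.ssubsets, ∑ j ∈ Finset.Icc 1 n, St.E n (St.wd d J j) (xvMon n j 1))
        ∈ St.K n (n - t + 1) d := by
      refine Submodule.sum_mem _ fun J hJ => ?_
      have h := hss J hJ
      exact St.K_mono (by omega) (St.relJ (fun x hx => hTn x (h.1 hx)) (by omega))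
    have m2 : (∑ u ∈ T, (St.E n (St.wd d (T.erase t) t) (xvMon n u 1)
        + ∑ J ∈ T.ssubsets, St.E n (St.wd d J u) (xvMon n u 1))) ∈ St.K n (n - t + 1) d := by
      refine Submodule.sum_mem _ fun u hu => ?_
      rw [← hcard]
      exact St.per_u hTn htT hu (by omega)
    have hun : Finset.Icc 1 n = Finset.Icc 1 (t - 1) ∪ T := by
      ext x; rw [hT, Finset.mem_union]; simp only [Finset.mem_Icc]; omega
    have hdis : Disjoint (Finset.Icc 1 (t - 1)) T := by
      rw [Finset.disjoint_left]; intro x hx hx'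
      rw [hT] at hx'
      rw [Finset.mem_Icc] at hx hx'; omega
    rw [Finset.sum_comm, hun, Finset.sum_union hdis] at m1
    rw [Finset.sum_add_distrib] at m2
    have m3 := Submodule.sub_mem _ (Submodule.add_mem _ m1 m2)
      (Submodule.zero_mem (St.K n (n - t + 1) d))
    have z := St.two_zero (∑ u ∈ T, ∑ J ∈ T.ssubsets, St.E n (St.wd d J u) (xvMon n u 1))
    convert m3 using 1
    linear_combination -z
  · refine MvPolynomial.IsHomogeneous.add ?_ ?_
    · refine MvPolynomial.IsHomogeneous.sum _ _ _ fun u hu => ?_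
      have h := hTn u hu
      exact hhom _ _ _ (Finset.erase_subset _ _) (by omega) ht2 h.1 h.2 (by omega)
    · refine MvPolynomial.IsHomogeneous.sum _ _ _ fun j hj => ?_
      refine MvPolynomial.IsHomogeneous.sum _ _ _ fun J hJ => ?_
      rw [Finset.mem_Icc] at hj
      have h := hss J hJ
      exact hhom _ _ _ h.1 hj.1 (by omega) hj.1 (by omega) (by omega)
end
end
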